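/- arXiv:1308.5451 — 6 statements merged into one kernel-verified Lean document; each statement's English description precedes it below -/
import Mathlib

section
/- Let K be a field, n ≥ 3, and let i be an index with 1 ≤ i ≤ n−2 (so that rows/columns i, i+1, i+2 exist). For t ∈ K let x_i(t) and x_{i+1}(t) denote the n×n matrices 1 + t·E_{i,i+1} and 1 + t·E_{i+1,i+2} respectively, where E_{p,q} is the matrix with a single 1 in position (p,q). Then for all a, b, c ∈ K with a + c ≠ 0: x_i(a) · x_{i+1}(b) · x_i(c) = x_{i+1}(bc/(a+c)) · x_i(a+c) · x_{i+1}(ab/(a+c)). (This is the m = 3 braid relation of Proposition 2.2 for the one-parameter subgroups x_i in type A.) -/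
/-- The one-parameter subgroup `x_i(t) = 1 + t·E_{i,i+1}` (indices `0`-based:
rows/columns `i` and `i+1` of an `n×n` matrix). -/
def elemX (K : Type*) [Field K] (n i : ℕ) (t : K) : Matrix (Fin n) (Fin n) K :=
  1 + Matrix.of (fun p q : Fin n => if (p : ℕ) = i ∧ (q : ℕ) = i + 1 then t else 0)

theorem elemX_eq_transvection {K : Type*} [Field K] {n i : ℕ} (p q : Fin n) (hp : (p : ℕ) = i)
    (hq : (q : ℕ) = i + 1) (t : K) : elemX K n i t = Matrix.transvection p q t := by
  unfold elemX Matrix.transvection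
  congr 1
  ext r s
  simp only [Matrix.of_apply, Matrix.single_apply, Fin.ext_iff, hp, hq, eq_comm]

/-- The braid relation for transvections along three distinct indices. -/
theorem transvection_braid {K ι : Type*} [Field K] [Fintype ι] [DecidableEq ι] {p q r : ι}
    (hpq : p ≠ q) (hqr : q ≠ r) (hpr : p ≠ r) (a b c : K) (hac : a + c ≠ 0) :
    Matrix.transvection p q a * Matrix.transvection q r b * Matrix.transvection p q c =
      Matrix.transvection q r (b * c / (a + c)) * Matrix.transvection p q (a + c) *
        Matrix.transvection q r (a * b / (a + c)) := by
  have hb : b = b * c / (a + c) + a * b / (a + c) := by field_simp; ring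
  have hab : (a + c) * (a * b / (a + c)) = a * b := by field_simp
  simp only [Matrix.transvection, mul_add, add_mul, one_mul, mul_one,
    Matrix.single_mul_single_same, Matrix.single_mul_single_of_ne _ _ _ _ hpq.symm,
    Matrix.single_mul_single_of_ne _ _ _ _ hqr.symm,
    Matrix.single_mul_single_of_ne _ _ _ _ hpr.symm, hab, add_zero]
  conv_lhs => enter [1, 2, 1]; rw [hb]
  simp only [Matrix.single_add]
  abel

/-- The `m = 3` braid relation of Proposition 2.2 for the one-parameter subgroups
`x_i` in type A:
`x_i(a) x_{i+1}(b) x_i(c) = x_{i+1}(bc/(a+c)) x_i(a+c) x_{i+1}(ab/(a+c))`. -/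
theorem braid_m3_upper {K : Type*} [Field K] (n i : ℕ) (hi : i + 2 < n)
    (a b c : K) (hac : a + c ≠ 0) :
    elemX K n i a * elemX K n (i + 1) b * elemX K n i c =
      elemX K n (i + 1) (b * c / (a + c)) * elemX K n i (a + c) *
        elemX K n (i + 1) (a * b / (a + c)) := by
  rw [elemX_eq_transvection ⟨i, by omega⟩ ⟨i + 1, by omega⟩ rfl rfl,
    elemX_eq_transvection ⟨i, by omega⟩ ⟨i + 1, by omega⟩ rfl rfl,
    elemX_eq_transvection ⟨i, by omega⟩ ⟨i + 1, by omega⟩ rfl rfl,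
    elemX_eq_transvection ⟨i + 1, by omega⟩ ⟨i + 2, hi⟩ rfl rfl,
    elemX_eq_transvection ⟨i + 1, by omega⟩ ⟨i + 2, hi⟩ rfl rfl,
    elemX_eq_transvection ⟨i + 1, by omega⟩ ⟨i + 2, hi⟩ rfl rfl]
  exact transvection_braid (by simp) (by simp) (by simp) a b c hac
end

section
/- Let K be a field, n ≥ 3, and let i be an index with 1 ≤ i ≤ n−2. For t ∈ K with t ≠ 0 let x_{−i}(t) denote the n×n matrix equal to the identity except in the 2×2 block on rows and columns {i, i+1}, where it equals [[t⁻¹, 0],[1, t]], and let x_{−(i+1)}(t) be the analogous matrix on rows and columns {i+1, i+2}. Then for all a, b, c ∈ K with a ≠ 0, b ≠ 0, c ≠ 0 and b + ac ≠ 0: x_{−i}(a) · x_{−(i+1)}(b) · x_{−i}(c) = x_{−(i+1)}(bc/(b+ac)) · x_{−i}(ac) · x_{−(i+1)}(a + b/c). (This is the m = 3 braid relation of Proposition 2.2 for the one-parameter subgroups x_{−i} in type A.) -/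
/-- The one-parameter subgroup `x_{−i}(t)`: the `n×n` matrix equal to the identity
except in the `2×2` block on rows and columns `{i, i+1}` (`0`-based), where it equals
`[[t⁻¹, 0], [1, t]]`. -/
def elemXneg (K : Type*) [Field K] (n i : ℕ) (t : K) : Matrix (Fin n) (Fin n) K :=
  Matrix.of fun p q : Fin n =>
    if (p : ℕ) = i ∧ (q : ℕ) = i then t⁻¹
    else if (p : ℕ) = i ∧ (q : ℕ) = i + 1 then 0
    else if (p : ℕ) = i + 1 ∧ (q : ℕ) = i then 1
    else if (p : ℕ) = i + 1 ∧ (q : ℕ) = i + 1 then t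
    else if p = q then 1 else 0

/-- Left multiplication by `x_{−i}(t)` only changes the rows `i` and `i + 1`. -/
theorem elemXneg_mul_apply {K : Type*} [Field K] {n i : ℕ} (hi : i + 1 < n) (t : K)
    (M : Matrix (Fin n) (Fin n) K) (p q : Fin n) :
    (elemXneg K n i t * M) p q =
      if (p : ℕ) = i then t⁻¹ * M ⟨i, by omega⟩ q
      else if (p : ℕ) = i + 1 then M ⟨i, by omega⟩ q + t * M ⟨i + 1, hi⟩ q
      else M p q := by
  rw [Matrix.mul_apply]
  split_ifs with h h'
  · rw [Fintype.sum_eq_single (⟨i, by omega⟩ : Fin n)]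
    · simp [elemXneg, h]
    · intro r hr
      have hri : (r : ℕ) ≠ i := fun e => hr (Fin.ext e)
      have hpr : p ≠ r := by rintro rfl; exact hri h
      simp [elemXneg, h, hri, hpr]
  · rw [Fintype.sum_eq_add (⟨i, by omega⟩ : Fin n) ⟨i + 1, hi⟩ (by simp)]
    · simp [elemXneg, h']
    · rintro r ⟨hr, hr'⟩
      have hri : (r : ℕ) ≠ i := fun e => hr (Fin.ext e)
      have hri' : (r : ℕ) ≠ i + 1 := fun e => hr' (Fin.ext e)
      have hpr : p ≠ r := by rintro rfl; exact hri' h'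
      simp [elemXneg, h', hri, hri', hpr]
  · rw [Fintype.sum_eq_single p]
    · simp [elemXneg, h, h']
    · intro r hr
      simp [elemXneg, h, h', hr.symm]

/-- The `m = 3` braid relation of Proposition 2.2 for the one-parameter subgroups
`x_{−i}` in type A:
`x_{−i}(a) x_{−(i+1)}(b) x_{−i}(c) = x_{−(i+1)}(bc/(b+ac)) x_{−i}(ac) x_{−(i+1)}(a + b/c)`. -/
theorem braid_m3_lower {K : Type*} [Field K] (n i : ℕ) (hi : i + 2 < n)
    (a b c : K) (ha : a ≠ 0) (hb : b ≠ 0) (hc : c ≠ 0) (hbac : b + a * c ≠ 0) :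
    elemXneg K n i a * elemXneg K n (i + 1) b * elemXneg K n i c =
      elemXneg K n (i + 1) (b * c / (b + a * c)) * elemXneg K n i (a * c) *
        elemXneg K n (i + 1) (a + b / c) := by
  rw [← Matrix.mul_one (_ * _ * elemXneg K n i c),
    ← Matrix.mul_one (_ * _ * elemXneg K n (i + 1) (a + b / c))]
  generalize (1 : Matrix (Fin n) (Fin n) K) = M
  have hT : a + b / c = (b + a * c) / c := by field_simp; ring
  obtain ⟨d, hd⟩ : ∃ d, d = b + a * c := ⟨_, rfl⟩
  rw [← hd] at hbac hT
  have hne : i ≠ i + 1 + 1 := by omega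
  ext p q
  simp only [Matrix.mul_assoc, elemXneg_mul_apply (show i + 1 < n by omega),
    elemXneg_mul_apply (show i + 1 + 1 < n from hi), hT, ← hd]
  by_cases h₀ : (p : ℕ) = i
  · simp [h₀, hne]
    field_simp
  by_cases h₁ : (p : ℕ) = i + 1
  · simp [h₁, hne]
    field_simp
    rw [hd]
    ring
  by_cases h₂ : (p : ℕ) = i + 1 + 1
  · simp [h₂, hne, hne.symm]
    field_simp
    rw [hd]
    ring
  simp [h₀, h₁, h₂]
end

section
/- Let Ω = {(a,b,c) ∈ ℝ³ : a > 0, b > 0, c > 0} and define Φ: Ω → ℝ³ by Φ(a,b,c) = (e, f, g) where e = bc/(b+ac), f = ac, g = a + b/c. Then Φ is differentiable on Ω and at every point of Ω the determinant of its Jacobian matrix (the 3×3 matrix of partial derivatives ∂(e,f,g)/∂(a,b,c)) equals e·f·g/(a·b·c), which moreover equals 1. (This is the Jacobian computation verifying, in the m = 3 case of Proposition 2.6, that the change of parameters between the toric charts x_{−𝐢} and x_{−𝐢'} preserves the logarithmic volume form da/a ∧ db/b ∧ dc/c.) -/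
/-- The change of parameters `(a,b,c) ↦ (e,f,g) = (bc/(b+ac), ac, a+b/c)` between the
toric charts `x_{−𝐢}` and `x_{−𝐢'}` (the `m = 3` case). -/
noncomputable def PhiNeg (p : Fin 3 → ℝ) : Fin 3 → ℝ :=
  ![p 1 * p 2 / (p 1 + p 0 * p 2), p 0 * p 2, p 0 + p 1 / p 2]

/-- The total derivative of `PhiNeg` wherever its denominators do not vanish. -/
theorem hasFDerivAt_PhiNeg (p : Fin 3 → ℝ) (hc : p 2 ≠ 0) (hd : p 1 + p 0 * p 2 ≠ 0) :
    HasFDerivAt PhiNeg (LinearMap.toContinuousLinearMap (Matrix.toLin'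
      !![-(p 1 * p 2 ^ 2) / (p 1 + p 0 * p 2) ^ 2, p 0 * p 2 ^ 2 / (p 1 + p 0 * p 2) ^ 2,
          p 1 ^ 2 / (p 1 + p 0 * p 2) ^ 2;
        p 2, 0, p 0;
        1, 1 / p 2, -p 1 / p 2 ^ 2])) p := by
  have h (i : Fin 3) := hasFDerivAt_apply (𝕜 := ℝ) i p
  rw [hasFDerivAt_pi']
  intro i
  fin_cases i
  · refine (((h 1).mul (h 2)).mul ((hasDerivAt_inv hd).comp_hasFDerivAt p
      ((h 1).add ((h 0).mul (h 2))))).congr_fderiv ?_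
    ext v
    simp [dotProduct, Fin.sum_univ_three]
    field_simp
    ring
  · refine ((h 0).mul (h 2)).congr_fderiv ?_
    ext v
    simp [dotProduct, Fin.sum_univ_three]
    ring
  · refine ((h 0).add ((h 1).mul ((hasDerivAt_inv hc).comp_hasFDerivAt p (h 2)))).congr_fderiv ?_
    ext v
    simp [dotProduct, Fin.sum_univ_three]
    field_simp
    ring

/-- The Jacobian computation of Proposition 2.6 for the charts `x_{−𝐢}`:
on the positive octant the map is differentiable, its Jacobian determinant equals
`efg/(abc)`, and this equals `1`; hence the logarithmic volume form is preserved. -/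
theorem jacobian_m3_lower (p : Fin 3 → ℝ)
    (ha : 0 < p 0) (hb : 0 < p 1) (hc : 0 < p 2) :
    DifferentiableAt ℝ PhiNeg p ∧
      (Matrix.of fun i j : Fin 3 => fderiv ℝ PhiNeg p (Pi.single j 1) i).det =
        (p 1 * p 2 / (p 1 + p 0 * p 2)) * (p 0 * p 2) * (p 0 + p 1 / p 2) /
          (p 0 * p 1 * p 2) ∧
      (Matrix.of fun i j : Fin 3 => fderiv ℝ PhiNeg p (Pi.single j 1) i).det = 1 := by
  have hd : p 1 + p 0 * p 2 ≠ 0 := by positivity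
  have h := hasFDerivAt_PhiNeg p hc.ne' hd
  have hdet : (Matrix.of fun i j : Fin 3 => fderiv ℝ PhiNeg p (Pi.single j 1) i).det = 1 := by
    rw [h.fderiv, Matrix.det_fin_three]
    simp
    field_simp
    ring
  refine ⟨h.differentiableAt, ?_, hdet⟩
  rw [hdet]
  field_simp
  ring
end

section
/- Let Ω = {(a,b,c) ∈ ℝ³ : a > 0, b > 0, c > 0} and define Φ: Ω → ℝ³ by Φ(a,b,c) = (e, f, g) where e = bc/(a+c), f = a + c, g = ab/(a+c). Then Φ is differentiable on Ω and at every point of Ω the determinant of its Jacobian matrix equals e·f·g/(a·b·c), which moreover equals b/(a+c). (This is the Jacobian computation verifying, in the m = 3 case of Proposition 2.6, that the change of parameters between the toric charts x_{𝐢} and x_{𝐢'} of U^{w₀} preserves the logarithmic volume form da/a ∧ db/b ∧ dc/c.) -/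
/-- The change of parameters `(a,b,c) ↦ (e,f,g) = (bc/(a+c), a+c, ab/(a+c))` between
the toric charts `x_𝐢` and `x_{𝐢'}` of `U^{w₀}` (the `m = 3` case). -/
noncomputable def PhiPos (p : Fin 3 → ℝ) : Fin 3 → ℝ :=
  ![p 1 * p 2 / (p 0 + p 2), p 0 + p 2, p 0 * p 1 / (p 0 + p 2)]

/-- The derivative of `PhiPos` is given by its Jacobian matrix. -/
theorem hasFDerivAt_PhiPos (p : Fin 3 → ℝ) (h : p 0 + p 2 ≠ 0) :
    HasFDerivAt PhiPos
      (Matrix.toLin' !![-(p 1 * p 2) / (p 0 + p 2) ^ 2, p 2 / (p 0 + p 2),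
          p 0 * p 1 / (p 0 + p 2) ^ 2;
        1, 0, 1;
        p 1 * p 2 / (p 0 + p 2) ^ 2, p 0 / (p 0 + p 2),
          -(p 0 * p 1) / (p 0 + p 2) ^ 2]).toContinuousLinearMap p := by
  have coord (i : Fin 3) : HasFDerivAt (fun q : Fin 3 → ℝ => q i)
      (ContinuousLinearMap.proj i : (Fin 3 → ℝ) →L[ℝ] ℝ) p := hasFDerivAt_apply i p
  have hsum := (coord 0).add (coord 2)
  have hinv := (hasDerivAt_inv h).comp_hasFDerivAt p hsum
  rw [hasFDerivAt_pi']
  intro i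
  fin_cases i
  · refine (((coord 1).mul (coord 2)).mul hinv).congr_fderiv ?_
    ext v
    simp [dotProduct, Fin.sum_univ_three]
    field_simp
    ring
  · refine hsum.congr_fderiv ?_
    ext v
    simp [dotProduct, Fin.sum_univ_three]
  · refine (((coord 0).mul (coord 1)).mul hinv).congr_fderiv ?_
    ext v
    simp [dotProduct, Fin.sum_univ_three]
    field_simp
    ring

/-- The Jacobian computation of Proposition 2.6 for the charts `x_𝐢` of `U^{w₀}`:
on the positive octant the map is differentiable, its Jacobian determinant equals
`efg/(abc)`, and this equals `b/(a+c)`. -/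
theorem jacobian_m3_upper (p : Fin 3 → ℝ)
    (ha : 0 < p 0) (hb : 0 < p 1) (hc : 0 < p 2) :
    DifferentiableAt ℝ PhiPos p ∧
      (Matrix.of fun i j : Fin 3 => fderiv ℝ PhiPos p (Pi.single j 1) i).det =
        (p 1 * p 2 / (p 0 + p 2)) * (p 0 + p 2) * (p 0 * p 1 / (p 0 + p 2)) /
          (p 0 * p 1 * p 2) ∧
      (Matrix.of fun i j : Fin 3 => fderiv ℝ PhiPos p (Pi.single j 1) i).det =
        p 1 / (p 0 + p 2) := by
  have hs : p 0 + p 2 ≠ 0 := by positivity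
  have hd := hasFDerivAt_PhiPos p hs
  have hdet : (Matrix.of fun i j : Fin 3 => fderiv ℝ PhiPos p (Pi.single j 1) i).det =
      p 1 / (p 0 + p 2) := by
    rw [hd.fderiv, Matrix.det_fin_three]
    simp
    field_simp
    ring
  refine ⟨hd.differentiableAt, ?_, hdet⟩
  rw [hdet]
  field_simp
end

section
/- Let n ≥ 1 and λ ∈ ℂⁿ. Define f: ℝⁿ → ℂ by f(h) = Ψⁿ_λ(e^{h₁}, …, e^{hₙ}). Then f is smooth and satisfies the quantum Toda eigenfunction equation: for every h ∈ ℝⁿ, ½ Σ_{i=1}^n (∂²f/∂hᵢ²)(h) − ( Σ_{i=1}^{n−1} e^{h_{i+1} − h_i} ) f(h) = ½ ( Σ_{i=1}^n λᵢ² ) f(h). (This is the main Theorem 1.1/4.2 — the integral of λ(γ(x))e^{−F(x)} over the totally positive part of the geometric crystal is a Whittaker function, i.e. an eigenfunction of the quantum Toda Hamiltonian H = ½Δ − Σᵢ αᵢ(t) — made explicit for G = GL(n) via the Gelfand–Tsetlin-pattern integral (eq:tableau) of Section 5.1.) -/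
open MeasureTheory
open scoped BigOperators

noncomputable section

/-- Triangular Gelfand–Tsetlin-type arrays `(z_{k,j})` (0-based: rows
`k = 0, …, n−2`, row `k` having entries `j = 0, …, k`). -/
abbrev GTArray (n : ℕ) := (k : Fin (n - 1)) → Fin (k.1 + 1) → ℝ

/-- The entry `z_{k,j}` (0-based) of a triangular array, with the convention that
row `n−1` is given by `x`. Out-of-range indices (never used) yield `0`. -/
def Zent (n : ℕ) (x : Fin n → ℝ) (z : GTArray n) (k j : ℕ) : ℝ :=
  if hk : k < n - 1 then
    if hj : j < k + 1 then z ⟨k, hk⟩ ⟨j, hj⟩ else 0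
  else if hj : j < n then x ⟨j, hj⟩ else 0

/-- The superpotential/decoration
`F(z;x) = Σ_{0≤j≤k≤n−2} ( z_{k+1,j+1}/z_{k,j} + z_{k,j}/z_{k+1,j} )`
(0-based form of `Σ_{1≤j≤k≤n−1}` in 1-based indexing). -/
def Ffun (n : ℕ) (x : Fin n → ℝ) (z : GTArray n) : ℝ :=
  ∑ k ∈ Finset.range (n - 1), ∑ j ∈ Finset.range (k + 1),
    (Zent n x z (k + 1) (j + 1) / Zent n x z k j +
      Zent n x z k j / Zent n x z (k + 1) j)

/-- The weight
`w_λ(z;x) = Π_{k} ( Π_{j≤k} z_{k,j} / Π_{j≤k−1} z_{k−1,j} )^{−λ_k}`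
(0-based product over `k = 0, …, n−1`), with `t^s := exp(s·log t)` for `t > 0`. -/
def wfun (n : ℕ) (lam : Fin n → ℂ) (x : Fin n → ℝ) (z : GTArray n) : ℂ :=
  ∏ k ∈ Finset.range n,
    Complex.exp ((-(if hk : k < n then lam ⟨k, hk⟩ else 0)) *
      (Real.log ((∏ j ∈ Finset.range (k + 1), Zent n x z k j) /
        ∏ j ∈ Finset.range k, Zent n x z (k - 1) j) : ℂ))

/-- The positive orthant of triangular arrays. -/
def GTpos (n : ℕ) : Set (GTArray n) := {z | ∀ k j, 0 < z k j}

/-- The density `Π_{k,j} z_{k,j}⁻¹` of the measure `Π dz_{k,j}/z_{k,j}` with respect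
to Lebesgue measure. -/
def GTdens (n : ℕ) (z : GTArray n) : ℝ :=
  ∏ k : Fin (n - 1), ∏ j : Fin (k.1 + 1), (z k j)⁻¹

/-- The `GL(n)` Whittaker function
`Ψⁿ_λ(x) = ∫_{ℝ_{>0}^{n(n−1)/2}} w_λ(z;x) e^{−F(z;x)} Π dz_{k,j}/z_{k,j}`
(normalization of Corwin–O'Connell–Seppäläinen–Zygouras). -/
def Psi (n : ℕ) (lam : Fin n → ℂ) (x : Fin n → ℝ) : ℂ :=
  ∫ z in GTpos n,
    wfun n lam x z * (Real.exp (-Ffun n x z) : ℂ) * (GTdens n z : ℂ)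

end

section ExponentialPolynomials

open Filter Topology

variable {X : Type*} [NormedAddCommGroup X] [NormedSpace ℝ X]

variable (X) in
/-- The algebra of exponential polynomials: complex combinations of the functions
`x ↦ exp (ℓ x)` with `ℓ` a continuous real-linear functional with complex values. -/
def expPoly : Subalgebra ℂ (X → ℂ) :=
  Algebra.adjoin ℂ (Set.range fun (ℓ : X →L[ℝ] ℂ) (x : X) => Complex.exp (ℓ x))

theorem cexp_clm_mem_expPoly (ℓ : X →L[ℝ] ℂ) : (fun x => Complex.exp (ℓ x)) ∈ expPoly X :=
  Algebra.subset_adjoin ⟨ℓ, rfl⟩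

theorem contDiff_of_mem_expPoly {p : X → ℂ} (hp : p ∈ expPoly X) {m : WithTop ℕ∞} :
    ContDiff ℝ m p := by
  refine Algebra.adjoin_induction (p := fun p _ => ContDiff ℝ m p) ?_ ?_ ?_ ?_ hp
  · rintro _ ⟨ℓ, rfl⟩
    exact ℓ.contDiff.cexp
  · intro r
    exact contDiff_const
  · intro p q _ _ hp hq
    exact hp.add hq
  · intro p q _ _ hp hq
    exact hp.mul hq

theorem differentiable_of_mem_expPoly {p : X → ℂ} (hp : p ∈ expPoly X) : Differentiable ℝ p :=
  (contDiff_of_mem_expPoly hp (m := 1)).differentiable one_ne_zero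

theorem fderiv_apply_mem_expPoly {p : X → ℂ} (hp : p ∈ expPoly X) (v : X) :
    (fun x => fderiv ℝ p x v) ∈ expPoly X := by
  refine Algebra.adjoin_induction (p := fun p _ => (fun x => fderiv ℝ p x v) ∈ expPoly X)
    ?_ ?_ ?_ ?_ hp
  · rintro _ ⟨ℓ, rfl⟩
    have h : (fun x => fderiv ℝ (fun x => Complex.exp (ℓ x)) x v)
        = (ℓ v) • fun x => Complex.exp (ℓ x) := by
      ext x
      rw [(ℓ.hasFDerivAt.cexp).fderiv]
      simp [mul_comm]
    rw [h]
    exact Subalgebra.smul_mem _ (cexp_clm_mem_expPoly ℓ) _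
  · intro r
    have h : (fun x => fderiv ℝ (algebraMap ℂ (X → ℂ) r) x v) = 0 := by
      ext x
      have : algebraMap ℂ (X → ℂ) r = fun _ => r := rfl
      rw [this]
      simp
    rw [h]
    exact zero_mem _
  · intro p q hp hq ihp ihq
    have h : (fun x => fderiv ℝ (p + q) x v)
        = (fun x => fderiv ℝ p x v) + fun x => fderiv ℝ q x v := by
      ext x
      rw [fderiv_add (differentiable_of_mem_expPoly hp x) (differentiable_of_mem_expPoly hq x)]
      rfl
    rw [h]
    exact add_mem ihp ihq
  · intro p q hp hq ihp ihq
    have h : (fun x => fderiv ℝ (p * q) x v)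
        = p * (fun x => fderiv ℝ q x v) + q * fun x => fderiv ℝ p x v := by
      ext x
      rw [fderiv_mul (differentiable_of_mem_expPoly hp x) (differentiable_of_mem_expPoly hq x)]
      rfl
    rw [h]
    exact add_mem (mul_mem hp ihq) (mul_mem hq ihp)

theorem exists_growth_of_mem_expPoly {p : X → ℂ} (hp : p ∈ expPoly X) :
    ∃ C K : ℝ, 0 ≤ C ∧ 0 ≤ K ∧ ∀ x, ‖p x‖ ≤ C * Real.exp (K * ‖x‖) ∧
      ‖fderiv ℝ p x‖ ≤ C * Real.exp (K * ‖x‖) := by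
  have key : ∀ {C D K L : ℝ} (x : X), 0 ≤ D → 0 ≤ L → C ≤ D → K ≤ L →
      C * Real.exp (K * ‖x‖) ≤ D * Real.exp (L * ‖x‖) := by
    intro C D K L x hD hL hCD hKL
    gcongr
  refine Algebra.adjoin_induction (p := fun p _ => ∃ C K : ℝ, 0 ≤ C ∧ 0 ≤ K ∧
    ∀ x, ‖p x‖ ≤ C * Real.exp (K * ‖x‖) ∧ ‖fderiv ℝ p x‖ ≤ C * Real.exp (K * ‖x‖))
    ?_ ?_ ?_ ?_ hp
  · rintro _ ⟨ℓ, rfl⟩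
    refine ⟨1 + ‖ℓ‖, ‖ℓ‖, by positivity, by positivity, fun x => ?_⟩
    have h : ‖Complex.exp (ℓ x)‖ ≤ Real.exp (‖ℓ‖ * ‖x‖) := by
      rw [Complex.norm_exp]
      exact Real.exp_le_exp.2 ((Complex.re_le_norm _).trans (ℓ.le_opNorm x))
    constructor
    · refine h.trans ?_
      nlinarith [Real.exp_pos (‖ℓ‖ * ‖x‖), norm_nonneg ℓ]
    · rw [(ℓ.hasFDerivAt.cexp).fderiv, norm_smul]
      nlinarith [Real.exp_pos (‖ℓ‖ * ‖x‖), norm_nonneg ℓ]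
  · intro r
    refine ⟨‖r‖, 0, by positivity, le_rfl, fun x => ?_⟩
    have : algebraMap ℂ (X → ℂ) r = fun _ => r := rfl
    rw [this]
    simp
  · rintro p q hp hq ⟨C, K, hC, hK, ihp⟩ ⟨D, L, hD, hL, ihq⟩
    refine ⟨C + D, K + L, by positivity, by positivity, fun x => ?_⟩
    have h1 := key (C := C) (K := K) x hC (by positivity : 0 ≤ K + L) le_rfl (by linarith)
    have h2 := key (C := D) (K := L) x hD (by positivity : 0 ≤ K + L) le_rfl (by linarith)
    rw [fderiv_add (differentiable_of_mem_expPoly hp x) (differentiable_of_mem_expPoly hq x),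
      add_mul]
    exact ⟨(norm_add_le _ _).trans (add_le_add ((ihp x).1.trans h1) ((ihq x).1.trans h2)),
      (norm_add_le _ _).trans (add_le_add ((ihp x).2.trans h1) ((ihq x).2.trans h2))⟩
  · rintro p q hp hq ⟨C, K, hC, hK, ihp⟩ ⟨D, L, hD, hL, ihq⟩
    refine ⟨2 * (C * D), K + L, by positivity, by positivity, fun x => ?_⟩
    obtain ⟨p1, p2⟩ := ihp x
    obtain ⟨q1, q2⟩ := ihq x
    have e : 2 * (C * D) * Real.exp ((K + L) * ‖x‖)
        = (C * Real.exp (K * ‖x‖)) * (D * Real.exp (L * ‖x‖))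
          + (D * Real.exp (L * ‖x‖)) * (C * Real.exp (K * ‖x‖)) := by
      rw [add_mul, Real.exp_add]
      ring
    have b1 : 0 ≤ C * Real.exp (K * ‖x‖) := by positivity
    have b2 : 0 ≤ D * Real.exp (L * ‖x‖) := by positivity
    rw [fderiv_mul (differentiable_of_mem_expPoly hp x) (differentiable_of_mem_expPoly hq x), e]
    constructor
    · rw [Pi.mul_apply, norm_mul]
      have := mul_le_mul p1 q1 (norm_nonneg _) b1
      nlinarith [mul_nonneg b1 b2]
    · refine (norm_add_le _ _).trans (add_le_add ?_ ?_)
      · rw [norm_smul]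
        exact mul_le_mul p1 q2 (norm_nonneg _) b1
      · rw [norm_smul]
        exact mul_le_mul q1 p2 (norm_nonneg _) b2

end ExponentialPolynomials

section ParametricIntegral

open Filter Topology

variable {T H : Type*} [NormedAddCommGroup T] [NormedSpace ℝ T] [FiniteDimensional ℝ T]
  [MeasurableSpace T] [BorelSpace T] [NormedAddCommGroup H] [NormedSpace ℝ H]
  {μ : Measure T} [μ.IsAddHaarMeasure]

theorem integrable_exp_neg_norm : Integrable (fun t : T => Real.exp (-‖t‖)) μ := by
  set N := Module.finrank ℝ T + 1 with hN
  have h := (integrable_one_add_norm (E := T) (μ := μ) (r := N) (by simp [hN])).const_mul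
    (Real.exp 1 * N.factorial)
  refine h.mono' (by fun_prop) (Eventually.of_forall fun t => ?_)
  have h1 := Real.pow_div_factorial_le_exp (1 + ‖t‖) (by positivity) N
  have h0 : 0 < (1 + ‖t‖) ^ N := by positivity
  rw [Real.norm_of_nonneg (Real.exp_pos _).le, Real.rpow_neg (by positivity), Real.rpow_natCast,
    ← div_eq_mul_inv, le_div_iff₀ h0]
  rw [div_le_iff₀ (by positivity), Real.exp_add] at h1
  calc Real.exp (-‖t‖) * (1 + ‖t‖) ^ N
      ≤ Real.exp (-‖t‖) * (Real.exp 1 * Real.exp ‖t‖ * N.factorial) := by gcongr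
    _ = Real.exp 1 * N.factorial * (Real.exp (-‖t‖) * Real.exp ‖t‖) := by ring
    _ = _ := by rw [← Real.exp_add]; simp

omit [NormedSpace ℝ H] in
theorem integrable_slice_of_exp_decay {E : Type*} [NormedAddCommGroup E] {g : T × H → E}
    (hg : Continuous g) {C K : ℝ}
    (hb : ∀ x, ‖g x‖ ≤ C * Real.exp (K * ‖x.2‖ - ‖x.1‖)) (h : H) :
    Integrable (fun t => g (t, h)) μ := by
  refine ((integrable_exp_neg_norm (μ := μ)).const_mul (C * Real.exp (K * ‖h‖))).mono'
    (by fun_prop) (Eventually.of_forall fun t => (hb _).trans_eq ?_)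
  rw [mul_assoc, ← Real.exp_add]
  rfl

/-- Translating the integration variable together with the parameter yields, in one formula,
differentiation under the integral sign and integration by parts. -/
theorem hasFDerivAt_integral_of_exp_decay {g : T × H → ℂ} (hg : ContDiff ℝ 1 g) {C K : ℝ}
    (hC : 0 ≤ C) (hK : 0 ≤ K)
    (hb : ∀ x, ‖g x‖ ≤ C * Real.exp (K * ‖x.2‖ - ‖x.1‖))
    (hb' : ∀ x, ‖fderiv ℝ g x‖ ≤ C * Real.exp (K * ‖x.2‖ - ‖x.1‖)) (h : H) :
    HasFDerivAt (fun y : T × H => ∫ t, g (t, y.2) ∂μ) (∫ t, fderiv ℝ g (t, h) ∂μ) (0, h) := by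
  have e : (fun y : T × H => ∫ t, g (t, y.2) ∂μ) = fun y : T × H => ∫ t, g ((t, 0) + y) ∂μ := by
    ext y
    rw [← integral_add_right_eq_self (fun t => g (t, y.2)) y.1]
    simp [Prod.add_def]
  have cg : Continuous g := hg.continuous
  have cg' : Continuous (fderiv ℝ g) := hg.continuous_fderiv one_ne_zero
  rw [e]
  have e2 : (∫ t, fderiv ℝ g (t, h) ∂μ) = ∫ t, fderiv ℝ g ((t, 0) + ((0 : T), h)) ∂μ := by simp
  rw [e2]
  refine hasFDerivAt_integral_of_dominated_of_fderiv_le (𝕜 := ℝ)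
    (F := fun (y : T × H) (t : T) => g ((t, 0) + y))
    (F' := fun (y : T × H) (t : T) => fderiv ℝ g ((t, 0) + y))
    (s := Metric.ball (0, h) 1)
    (bound := fun t => C * Real.exp (K * (‖h‖ + 1) + 1) * Real.exp (-‖t‖))
    (Metric.ball_mem_nhds _ one_pos) (Eventually.of_forall fun y => ?_) ?_ ?_ ?_
    (integrable_exp_neg_norm.const_mul _) ?_
  · exact Continuous.aestronglyMeasurable (by fun_prop)
  · simpa using integrable_slice_of_exp_decay cg hb h
  · exact Continuous.aestronglyMeasurable (by fun_prop)
  · refine Eventually.of_forall fun t y hy => (hb' _).trans ?_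
    rw [mul_assoc, ← Real.exp_add]
    have hd : ‖y - (0, h)‖ < 1 := by simpa [dist_eq_norm] using hy
    have h1 : ‖y.1‖ ≤ 1 := by simpa using (norm_fst_le (y - (0, h))).trans hd.le
    have h2 : ‖y.2 - h‖ ≤ 1 := by simpa using (norm_snd_le (y - (0, h))).trans hd.le
    have h3 : ‖y.2‖ ≤ ‖h‖ + 1 := by
      have := norm_add_le (y.2 - h) h
      rw [sub_add_cancel] at this
      linarith
    have h4 : ‖t‖ ≤ ‖t + y.1‖ + 1 := by
      have := norm_sub_le (t + y.1) y.1
      rw [add_sub_cancel_right] at this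
      linarith
    gcongr
    simp only [Prod.fst_add, Prod.snd_add, zero_add]
    nlinarith
  · refine Eventually.of_forall fun t y _ => ?_
    exact ((hg.differentiable one_ne_zero _).hasFDerivAt).comp y
      ((hasFDerivAt_id y).const_add (t, (0 : H)))

theorem integral_fderiv_fst_eq_zero_of_exp_decay {g : T × H → ℂ} (hg : ContDiff ℝ 1 g)
    {C K : ℝ} (hC : 0 ≤ C) (hK : 0 ≤ K)
    (hb : ∀ x, ‖g x‖ ≤ C * Real.exp (K * ‖x.2‖ - ‖x.1‖))
    (hb' : ∀ x, ‖fderiv ℝ g x‖ ≤ C * Real.exp (K * ‖x.2‖ - ‖x.1‖)) (h : H) (u : T) :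
    (∫ t, fderiv ℝ g (t, h) (u, 0) ∂μ) = 0 := by
  have hd := hasFDerivAt_integral_of_exp_decay (μ := μ) hg hC hK hb hb' h
  have hi := integrable_slice_of_exp_decay (μ := μ) (hg.continuous_fderiv one_ne_zero) hb' h
  rw [← ContinuousLinearMap.integral_apply hi]
  have hl : HasFDerivAt (fun s : T => (s, h)) (ContinuousLinearMap.inl ℝ T H) 0 :=
    hasFDerivAt_prodMk_left 0 h
  have hc := HasFDerivAt.comp (0 : T) hd hl
  have h0 := hc.unique (hasFDerivAt_const (∫ t, g (t, h) ∂μ) (0 : T))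
  simpa using congrArg (fun L : T →L[ℝ] ℂ => L u) h0

theorem hasFDerivAt_integral_snd_of_exp_decay {g : T × H → ℂ} (hg : ContDiff ℝ 1 g)
    {C K : ℝ} (hC : 0 ≤ C) (hK : 0 ≤ K)
    (hb : ∀ x, ‖g x‖ ≤ C * Real.exp (K * ‖x.2‖ - ‖x.1‖))
    (hb' : ∀ x, ‖fderiv ℝ g x‖ ≤ C * Real.exp (K * ‖x.2‖ - ‖x.1‖)) (h : H) :
    DifferentiableAt ℝ (fun h => ∫ t, g (t, h) ∂μ) h ∧
    ∀ v, fderiv ℝ (fun h => ∫ t, g (t, h) ∂μ) h v = ∫ t, fderiv ℝ g (t, h) (0, v) ∂μ := by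
  have hd := hasFDerivAt_integral_of_exp_decay (μ := μ) hg hC hK hb hb' h
  have hi := integrable_slice_of_exp_decay (μ := μ) (hg.continuous_fderiv one_ne_zero) hb' h
  have hr : HasFDerivAt (fun y : H => ((0 : T), y)) (ContinuousLinearMap.inr ℝ T H) h :=
    hasFDerivAt_prodMk_right 0 h
  have hc : HasFDerivAt (fun h => ∫ t, g (t, h) ∂μ)
      ((∫ t, fderiv ℝ g (t, h) ∂μ).comp (ContinuousLinearMap.inr ℝ T H)) h :=
    HasFDerivAt.comp (g := fun y : T × H => ∫ t, g (t, y.2) ∂μ) h hd hr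
  refine ⟨hc.differentiableAt, fun v => ?_⟩
  rw [hc.fderiv, ← ContinuousLinearMap.integral_apply hi]
  simp

end ParametricIntegral

section WeightedIntegral

open Filter Topology

variable {T H : Type*} [NormedAddCommGroup T] [NormedSpace ℝ T] [NormedAddCommGroup H]
  [NormedSpace ℝ H]

/-- `exp (-U (t, h))` decays in `t` faster than any exponential, with at most exponential
loss in `h`. -/
def ExpCoercive (U : T × H → ℂ) : Prop :=
  ∀ M : ℕ, ∃ C : ℝ, 0 ≤ C ∧
    ∀ x, ‖Complex.exp (-U x)‖ ≤ C * Real.exp (M * ‖x.2‖ - M * ‖x.1‖)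

/-- The derivative in direction `v`, conjugated by multiplication with `exp (-U)`. -/
noncomputable def twistedDeriv (U : T × H → ℂ) (v : T × H) (p : T × H → ℂ) : T × H → ℂ :=
  fun x => fderiv ℝ p x v - p x * fderiv ℝ U x v

theorem twistedDeriv_mem {U p : T × H → ℂ} (hU : U ∈ expPoly (T × H))
    (hp : p ∈ expPoly (T × H)) (v : T × H) : twistedDeriv U v p ∈ expPoly (T × H) :=
  sub_mem (fderiv_apply_mem_expPoly hp v) (mul_mem hp (fderiv_apply_mem_expPoly hU v))

theorem contDiff_mul_cexp_neg {U p : T × H → ℂ} (hU : U ∈ expPoly (T × H))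
    (hp : p ∈ expPoly (T × H)) {m : WithTop ℕ∞} :
    ContDiff ℝ m (fun x => p x * Complex.exp (-U x)) :=
  (contDiff_of_mem_expPoly hp).mul (contDiff_of_mem_expPoly hU).neg.cexp

theorem hasFDerivAt_mul_cexp_neg {U p : T × H → ℂ} (hU : U ∈ expPoly (T × H))
    (hp : p ∈ expPoly (T × H)) (x : T × H) :
    HasFDerivAt (fun x => p x * Complex.exp (-U x))
      (Complex.exp (-U x) • (fderiv ℝ p x - p x • fderiv ℝ U x)) x := by
  refine ((differentiable_of_mem_expPoly hp x).hasFDerivAt.mul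
    ((differentiable_of_mem_expPoly hU x).hasFDerivAt.neg.cexp)).congr_fderiv
      (ContinuousLinearMap.ext fun v => ?_)
  simp
  ring

theorem fderiv_mul_cexp_neg_apply {U p : T × H → ℂ} (hU : U ∈ expPoly (T × H))
    (hp : p ∈ expPoly (T × H)) (x v : T × H) :
    fderiv ℝ (fun x => p x * Complex.exp (-U x)) x v
      = twistedDeriv U v p x * Complex.exp (-U x) := by
  rw [(hasFDerivAt_mul_cexp_neg hU hp x).fderiv]
  simp [twistedDeriv, mul_comm]

theorem exists_decay_mul_cexp_neg {U p : T × H → ℂ} (hU : U ∈ expPoly (T × H))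
    (hc : ExpCoercive U) (hp : p ∈ expPoly (T × H)) :
    ∃ C K : ℝ, 0 ≤ C ∧ 0 ≤ K ∧
      (∀ x, ‖p x * Complex.exp (-U x)‖ ≤ C * Real.exp (K * ‖x.2‖ - ‖x.1‖)) ∧
      ∀ x, ‖fderiv ℝ (fun x => p x * Complex.exp (-U x)) x‖
        ≤ C * Real.exp (K * ‖x.2‖ - ‖x.1‖) := by
  obtain ⟨A, a, hA, ha, hpb⟩ := exists_growth_of_mem_expPoly hp
  obtain ⟨B, b, hB, hb, hUb⟩ := exists_growth_of_mem_expPoly hU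
  obtain ⟨M, hM⟩ := exists_nat_ge (a + b + 1)
  obtain ⟨D, hD, hw⟩ := hc M
  have main : ∀ x : T × H, Real.exp ((a + b) * ‖x‖) * Real.exp (M * ‖x.2‖ - M * ‖x.1‖)
      ≤ Real.exp ((2 * M) * ‖x.2‖ - ‖x.1‖) := by
    intro x
    rw [← Real.exp_add]
    refine Real.exp_le_exp.2 ?_
    have h1 : ‖x‖ ≤ ‖x.1‖ + ‖x.2‖ := by
      rw [Prod.norm_def]
      exact max_le_add_of_nonneg (norm_nonneg _) (norm_nonneg _)
    have h2 : (a + b) * ‖x‖ ≤ (M - 1) * (‖x.1‖ + ‖x.2‖) :=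
      mul_le_mul (by linarith) h1 (norm_nonneg _) (by linarith)
    nlinarith [norm_nonneg x.2]
  have grow : ∀ x : T × H, Real.exp (a * ‖x‖) ≤ Real.exp ((a + b) * ‖x‖) := by
    intro x
    gcongr
    linarith
  refine ⟨(A + A * B) * D, 2 * M, by positivity, by positivity, fun x => ?_, fun x => ?_⟩
  · rw [norm_mul]
    calc ‖p x‖ * ‖Complex.exp (-U x)‖
        ≤ ((A + A * B) * Real.exp ((a + b) * ‖x‖))
            * (D * Real.exp (M * ‖x.2‖ - M * ‖x.1‖)) := by
          refine mul_le_mul ((hpb x).1.trans ?_) (hw x) (norm_nonneg _) (by positivity)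
          refine mul_le_mul ?_ (grow x) (by positivity) (by positivity)
          nlinarith [mul_nonneg hA hB]
      _ = (A + A * B) * D
            * (Real.exp ((a + b) * ‖x‖) * Real.exp (M * ‖x.2‖ - M * ‖x.1‖)) := by ring
      _ ≤ _ := by
          gcongr
          exact main x
  · rw [(hasFDerivAt_mul_cexp_neg hU hp x).fderiv, norm_smul, mul_comm]
    have h1 : ‖fderiv ℝ p x - p x • fderiv ℝ U x‖
        ≤ (A + A * B) * Real.exp ((a + b) * ‖x‖) := by
      refine (norm_sub_le _ _).trans ?_
      rw [norm_smul, add_mul]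
      refine add_le_add ((hpb x).2.trans ?_) ?_
      · gcongr
        linarith
      · refine (mul_le_mul (hpb x).1 (hUb x).2 (norm_nonneg _) (by positivity)).trans_eq ?_
        rw [add_mul, Real.exp_add]
        ring
    calc ‖fderiv ℝ p x - p x • fderiv ℝ U x‖ * ‖Complex.exp (-U x)‖
        ≤ ((A + A * B) * Real.exp ((a + b) * ‖x‖))
            * (D * Real.exp (M * ‖x.2‖ - M * ‖x.1‖)) :=
          mul_le_mul h1 (hw x) (norm_nonneg _) (by positivity)
      _ = (A + A * B) * D
            * (Real.exp ((a + b) * ‖x‖) * Real.exp (M * ‖x.2‖ - M * ‖x.1‖)) := by ring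
      _ ≤ _ := by
          gcongr
          exact main x

variable [MeasurableSpace T]

/-- The integral over `t` of `p (t, h) exp (-U (t, h))`, as a function of `h`. -/
noncomputable def weightedIntegral (μ : Measure T) (U p : T × H → ℂ) (h : H) : ℂ :=
  ∫ t, p (t, h) * Complex.exp (-U (t, h)) ∂μ

variable [FiniteDimensional ℝ T] [BorelSpace T] {μ : Measure T} [μ.IsAddHaarMeasure]
  {U p q : T × H → ℂ}

theorem integrable_mul_cexp_neg (hU : U ∈ expPoly (T × H)) (hc : ExpCoercive U)
    (hp : p ∈ expPoly (T × H)) (h : H) :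
    Integrable (fun t => p (t, h) * Complex.exp (-U (t, h))) μ := by
  obtain ⟨C, K, -, -, hb, -⟩ := exists_decay_mul_cexp_neg hU hc hp
  exact integrable_slice_of_exp_decay
    (contDiff_mul_cexp_neg hU hp (m := 0)).continuous hb h

theorem weightedIntegral_add (hU : U ∈ expPoly (T × H)) (hc : ExpCoercive U)
    (hp : p ∈ expPoly (T × H)) (hq : q ∈ expPoly (T × H)) (h : H) :
    weightedIntegral μ U (p + q) h = weightedIntegral μ U p h + weightedIntegral μ U q h := by
  simp only [weightedIntegral, Pi.add_apply, add_mul]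
  exact integral_add (integrable_mul_cexp_neg hU hc hp h) (integrable_mul_cexp_neg hU hc hq h)

theorem weightedIntegral_sub (hU : U ∈ expPoly (T × H)) (hc : ExpCoercive U)
    (hp : p ∈ expPoly (T × H)) (hq : q ∈ expPoly (T × H)) (h : H) :
    weightedIntegral μ U (p - q) h = weightedIntegral μ U p h - weightedIntegral μ U q h := by
  simp only [weightedIntegral, Pi.sub_apply, sub_mul]
  exact integral_sub (integrable_mul_cexp_neg hU hc hp h) (integrable_mul_cexp_neg hU hc hq h)

theorem weightedIntegral_sum {ι : Type*} (s : Finset ι) {p : ι → T × H → ℂ}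
    (hU : U ∈ expPoly (T × H)) (hc : ExpCoercive U)
    (hp : ∀ i ∈ s, p i ∈ expPoly (T × H)) (h : H) :
    weightedIntegral μ U (∑ i ∈ s, p i) h = ∑ i ∈ s, weightedIntegral μ U (p i) h := by
  simp only [weightedIntegral, Finset.sum_apply, Finset.sum_mul]
  exact integral_finsetSum _ fun i hi => integrable_mul_cexp_neg hU hc (hp i hi) h

theorem weightedIntegral_twistedDeriv_fst (hU : U ∈ expPoly (T × H)) (hc : ExpCoercive U)
    (hp : p ∈ expPoly (T × H)) (u : T) (h : H) :
    weightedIntegral μ U (twistedDeriv U (u, 0) p) h = 0 := by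
  obtain ⟨C, K, hC, hK, hb, hb'⟩ := exists_decay_mul_cexp_neg hU hc hp
  rw [← integral_fderiv_fst_eq_zero_of_exp_decay (μ := μ)
    (contDiff_mul_cexp_neg hU hp) hC hK hb hb' h u]
  simp only [fderiv_mul_cexp_neg_apply hU hp]
  rfl

theorem differentiable_weightedIntegral (hU : U ∈ expPoly (T × H)) (hc : ExpCoercive U)
    (hp : p ∈ expPoly (T × H)) : Differentiable ℝ (weightedIntegral μ U p) := by
  obtain ⟨C, K, hC, hK, hb, hb'⟩ := exists_decay_mul_cexp_neg hU hc hp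
  exact fun h => (hasFDerivAt_integral_snd_of_exp_decay (μ := μ)
    (contDiff_mul_cexp_neg hU hp) hC hK hb hb' h).1

theorem fderiv_weightedIntegral (hU : U ∈ expPoly (T × H)) (hc : ExpCoercive U)
    (hp : p ∈ expPoly (T × H)) (h v : H) :
    fderiv ℝ (weightedIntegral μ U p) h v
      = weightedIntegral μ U (twistedDeriv U (0, v) p) h := by
  obtain ⟨C, K, hC, hK, hb, hb'⟩ := exists_decay_mul_cexp_neg hU hc hp
  refine ((hasFDerivAt_integral_snd_of_exp_decay (μ := μ)
    (contDiff_mul_cexp_neg hU hp) hC hK hb hb' h).2 v).trans ?_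
  simp only [fderiv_mul_cexp_neg_apply hU hp]
  rfl

theorem contDiff_weightedIntegral [FiniteDimensional ℝ H] (hU : U ∈ expPoly (T × H))
    (hc : ExpCoercive U) (hp : p ∈ expPoly (T × H)) :
    ContDiff ℝ (⊤ : ℕ∞) (weightedIntegral μ U p) := by
  rw [contDiff_infty]
  intro m
  induction m generalizing p with
  | zero => exact contDiff_zero.2 (differentiable_weightedIntegral hU hc hp).continuous
  | succ m ih =>
    push_cast
    rw [contDiff_succ_iff_fderiv_apply]
    refine ⟨differentiable_weightedIntegral hU hc hp, by simp, fun v => ?_⟩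
    simp only [fderiv_weightedIntegral hU hc hp]
    exact ih (twistedDeriv_mem hU hp _)

end WeightedIntegral

section GelfandTsetlinCoordinates

/-- The logarithmic entry `log z_{k,j}` as a linear functional of the logarithms of the array
and of its bottom row. -/
noncomputable def logEntry (n k j : ℕ) : GTArray n × (Fin n → ℝ) →L[ℝ] ℝ :=
  if hk : k < n - 1 then
    if hj : j < k + 1 then
      (ContinuousLinearMap.proj (R := ℝ) (φ := fun _ : Fin (k + 1) => ℝ) ⟨j, hj⟩).comp
        ((ContinuousLinearMap.proj (R := ℝ) (φ := fun k : Fin (n - 1) => Fin (k.1 + 1) → ℝ)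
          ⟨k, hk⟩).comp (ContinuousLinearMap.fst ℝ (GTArray n) (Fin n → ℝ)))
    else 0
  else if hj : j < n then
    (ContinuousLinearMap.proj (R := ℝ) (φ := fun _ : Fin n => ℝ) ⟨j, hj⟩).comp
      (ContinuousLinearMap.snd ℝ (GTArray n) (Fin n → ℝ))
  else 0

/-- The unit vector in the direction of the entry `(k, j)`. -/
noncomputable def entryDir (n k j : ℕ) : GTArray n × (Fin n → ℝ) :=
  if hk : k < n - 1 then
    if hj : j < k + 1 then (Pi.single ⟨k, hk⟩ (Pi.single ⟨j, hj⟩ 1), 0) else 0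
  else if hj : j < n then (0, Pi.single ⟨j, hj⟩ 1) else 0

theorem logEntry_apply (n k j : ℕ) (x : GTArray n × (Fin n → ℝ)) :
    logEntry n k j x = Zent n x.2 x.1 k j := by
  unfold logEntry Zent
  split_ifs <;> rfl

theorem Zent_exp {n k j : ℕ} (hk : k < n) (hj : j ≤ k) (t : GTArray n) (h : Fin n → ℝ) :
    Zent n (fun i => Real.exp (h i)) (fun k j => Real.exp (t k j)) k j
      = Real.exp (logEntry n k j (t, h)) := by
  rw [logEntry_apply]
  unfold Zent
  split_ifs <;> first | rfl | omega

theorem logEntry_entryDir {n k j k' j' : ℕ} (hk : k < n) (hj : j ≤ k) (hk' : k' < n)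
    (hj' : j' ≤ k') :
    logEntry n k j (entryDir n k' j') = if k = k' ∧ j = j' then 1 else 0 := by
  rw [logEntry_apply]
  unfold Zent entryDir
  by_cases h1 : k < n - 1 <;> by_cases h2 : k' < n - 1
  · have a1 : j < k + 1 := by omega
    have a2 : j' < k' + 1 := by omega
    simp only [h1, h2, a1, a2, dif_pos]
    by_cases e : k = k'
    · subst e
      simp [Pi.single_apply]
    · have : (⟨k, h1⟩ : Fin (n - 1)) ≠ ⟨k', h2⟩ := by simpa using e
      simp [e]
  · have a1 : j < k + 1 := by omega
    have a2 : j' < n := by omega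
    have : k ≠ k' := by omega
    simp [h1, h2, a1, a2, this]
  · have a1 : j < n := by omega
    have a2 : j' < k' + 1 := by omega
    have : k ≠ k' := by omega
    simp [h1, h2, a1, a2, this]
  · have a1 : j < n := by omega
    have a2 : j' < n := by omega
    have : k = k' := by omega
    simp [h2, a1, a2, this, Pi.single_apply]

/-- The logarithm of `z_{k+1,j+1} / z_{k,j}`. -/
noncomputable def logDiag (n k j : ℕ) : GTArray n × (Fin n → ℝ) →L[ℝ] ℝ :=
  logEntry n (k + 1) (j + 1) - logEntry n k j

/-- The logarithm of `z_{k,j} / z_{k+1,j}`. -/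
noncomputable def logVert (n k j : ℕ) : GTArray n × (Fin n → ℝ) →L[ℝ] ℝ :=
  logEntry n k j - logEntry n (k + 1) j

/-- The exponential of a real functional, as a complex-valued function. -/
noncomputable def cexpOfReal {X : Type*} [NormedAddCommGroup X] [NormedSpace ℝ X]
    (ℓ : X →L[ℝ] ℝ) (x : X) : ℂ :=
  Complex.exp (Complex.ofRealCLM.comp ℓ x)

theorem cexpOfReal_mem {X : Type*} [NormedAddCommGroup X] [NormedSpace ℝ X]
    (ℓ : X →L[ℝ] ℝ) : cexpOfReal ℓ ∈ expPoly X :=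
  cexp_clm_mem_expPoly _

theorem cexpOfReal_apply {X : Type*} [NormedAddCommGroup X] [NormedSpace ℝ X]
    (ℓ : X →L[ℝ] ℝ) (x : X) : cexpOfReal ℓ x = (Real.exp (ℓ x) : ℂ) := by
  simp [cexpOfReal]

theorem fderiv_cexpOfReal {X : Type*} [NormedAddCommGroup X] [NormedSpace ℝ X]
    (ℓ : X →L[ℝ] ℝ) (x v : X) :
    fderiv ℝ (cexpOfReal ℓ) x v = ℓ v * cexpOfReal ℓ x := by
  have h : HasFDerivAt (cexpOfReal ℓ) _ x := (Complex.ofRealCLM.comp ℓ).hasFDerivAt.cexp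
  rw [h.fderiv]
  simp [cexpOfReal, mul_comm]

/-- The superpotential in logarithmic coordinates. -/
noncomputable def potential (n : ℕ) : GTArray n × (Fin n → ℝ) → ℂ :=
  ∑ k ∈ Finset.range (n - 1), ∑ j ∈ Finset.range (k + 1),
    (cexpOfReal (logDiag n k j) + cexpOfReal (logVert n k j))

theorem potential_mem (n : ℕ) : potential n ∈ expPoly (GTArray n × (Fin n → ℝ)) :=
  sum_mem fun _ _ => sum_mem fun _ _ => add_mem (cexpOfReal_mem _) (cexpOfReal_mem _)

theorem Ffun_exp (n : ℕ) (t : GTArray n) (h : Fin n → ℝ) :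
    Ffun n (fun i => Real.exp (h i)) (fun k j => Real.exp (t k j))
      = ∑ k ∈ Finset.range (n - 1), ∑ j ∈ Finset.range (k + 1),
        (Real.exp (logDiag n k j (t, h)) + Real.exp (logVert n k j (t, h))) := by
  unfold Ffun
  refine Finset.sum_congr rfl fun k hk => Finset.sum_congr rfl fun j hj => ?_
  rw [Finset.mem_range] at hk hj
  rw [Zent_exp (by omega) (by omega), Zent_exp (by omega) (by omega),
    Zent_exp (by omega) (by omega), ← Real.exp_sub, ← Real.exp_sub]
  rfl

theorem potential_apply (n : ℕ) (t : GTArray n) (h : Fin n → ℝ) :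
    potential n (t, h)
      = (Ffun n (fun i => Real.exp (h i)) (fun k j => Real.exp (t k j)) : ℂ) := by
  rw [Ffun_exp]
  simp [potential, cexpOfReal_apply]

theorem Ffun_exp_nonneg (n : ℕ) (t : GTArray n) (h : Fin n → ℝ) :
    0 ≤ Ffun n (fun i => Real.exp (h i)) (fun k j => Real.exp (t k j)) := by
  rw [Ffun_exp]
  exact Finset.sum_nonneg fun k _ => Finset.sum_nonneg fun j _ => by positivity

theorem exp_logDiag_add_le_Ffun {n k j : ℕ} (hk : k < n - 1) (hj : j ≤ k) (t : GTArray n)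
    (h : Fin n → ℝ) :
    Real.exp (logDiag n k j (t, h)) + Real.exp (logVert n k j (t, h))
      ≤ Ffun n (fun i => Real.exp (h i)) (fun k j => Real.exp (t k j)) := by
  rw [Ffun_exp]
  refine le_trans ?_ (Finset.single_le_sum (f := fun k => ∑ j ∈ Finset.range (k + 1),
    (Real.exp (logDiag n k j (t, h)) + Real.exp (logVert n k j (t, h))))
    (fun _ _ => by positivity) (Finset.mem_range.2 hk))
  exact Finset.single_le_sum
    (f := fun j => Real.exp (logDiag n k j (t, h)) + Real.exp (logVert n k j (t, h)))
    (fun _ _ => by positivity) (Finset.mem_range.2 (Nat.lt_succ_of_le hj))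

theorem norm_le_add_log_one_add_Ffun {n : ℕ} (t : GTArray n) (h : Fin n → ℝ) :
    ‖t‖ ≤ ‖h‖ + n * Real.log
      (1 + Ffun n (fun i => Real.exp (h i)) (fun k j => Real.exp (t k j))) := by
  set F := Ffun n (fun i => Real.exp (h i)) (fun k j => Real.exp (t k j)) with hF
  have hF0 : 0 ≤ F := Ffun_exp_nonneg n t h
  set m := Real.log (1 + F) with hm
  have hm0 : 0 ≤ m := Real.log_nonneg (by linarith)
  have hd : ∀ k j, k < n - 1 → j ≤ k → logDiag n k j (t, h) ≤ m ∧ logVert n k j (t, h) ≤ m := by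
    intro k j hk hj
    have := exp_logDiag_add_le_Ffun hk hj t h
    rw [hm, Real.le_log_iff_exp_le (by linarith), Real.le_log_iff_exp_le (by linarith)]
    constructor
    · linarith [Real.exp_pos (logVert n k j (t, h))]
    · linarith [Real.exp_pos (logDiag n k j (t, h))]
  have key : ∀ d k j, k + d + 1 = n → j ≤ k → |logEntry n k j (t, h)| ≤ ‖h‖ + d * m := by
    intro d
    induction d with
    | zero =>
      intro k j hk hj
      have h1 : ¬ k < n - 1 := by omega
      have h2 : j < n := by omega
      rw [logEntry_apply]
      simpa [Zent, h1, h2] using norm_le_pi_norm h ⟨j, h2⟩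
    | succ d ih =>
      intro k j hk hj
      have h1 := ih (k + 1) (j + 1) (by omega) (by omega)
      have h2 := ih (k + 1) j (by omega) (by omega)
      obtain ⟨h3, h4⟩ := hd k j (by omega) hj
      simp only [logDiag, logVert, sub_apply] at h3 h4
      rw [abs_le] at h1 h2 ⊢
      push_cast
      constructor <;> linarith
  have h0 : 0 ≤ ‖h‖ + n * m := by positivity
  rw [pi_norm_le_iff_of_nonneg h0]
  intro k
  rw [pi_norm_le_iff_of_nonneg h0]
  intro j
  have hk := k.2
  have := key (n - 1 - k.1) k.1 j.1 (by omega) (by omega)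
  rw [logEntry_apply] at this
  simp only [Zent, hk, j.2, dif_pos] at this
  refine (Real.norm_eq_abs _).trans_le (this.trans ?_)
  have hle : ((n - 1 - k.1 : ℕ) : ℝ) ≤ n := by exact_mod_cast (by omega)
  gcongr

theorem expCoercive_potential (n : ℕ) : ExpCoercive (potential n) := by
  intro M
  refine ⟨Real.exp 1 * (n * M).factorial, by positivity, fun ⟨t, h⟩ => ?_⟩
  have hb := norm_le_add_log_one_add_Ffun t h
  rw [potential_apply]
  have hF0 := Ffun_exp_nonneg n t h
  set F := Ffun n (fun i => Real.exp (h i)) (fun k j => Real.exp (t k j)) with hF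
  have h1 := Real.pow_div_factorial_le_exp (1 + F) (by positivity) (n * M)
  rw [div_le_iff₀ (by positivity)] at h1
  have h2 : Real.exp (M * ‖t‖ - M * ‖h‖) ≤ (1 + F) ^ (n * M) := by
    have h3 : (1 + F) ^ (n * M) = Real.exp (((n * M : ℕ) : ℝ) * Real.log (1 + F)) := by
      rw [Real.exp_nat_mul, Real.exp_log (by linarith)]
    rw [h3, Real.exp_le_exp]
    push_cast
    have := mul_le_mul_of_nonneg_left hb (Nat.cast_nonneg (α := ℝ) M)
    linarith
  have h3 : ‖Complex.exp (-(F : ℂ))‖ = Real.exp (-F) := by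
    rw [Complex.norm_exp]
    simp
  rw [h3]
  have h4 := h2.trans h1
  calc Real.exp (-F) = Real.exp (-F) * Real.exp (M * ‖t‖ - M * ‖h‖)
        * Real.exp (M * ‖h‖ - M * ‖t‖) := by
        rw [mul_assoc, ← Real.exp_add]
        simp
    _ ≤ Real.exp (-F) * (Real.exp (1 + F) * (n * M).factorial)
        * Real.exp (M * ‖h‖ - M * ‖t‖) := by gcongr
    _ = _ := by
        rw [← mul_assoc (Real.exp (-F)), ← Real.exp_add]
        simp

/-- The parameter `λ_k`, extended by zero. -/
def weightAt (n : ℕ) (lam : Fin n → ℂ) (k : ℕ) : ℂ := if hk : k < n then lam ⟨k, hk⟩ else 0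

/-- The logarithm of the weight `w_λ` in logarithmic coordinates. -/
noncomputable def logWeight (n : ℕ) (lam : Fin n → ℂ) : GTArray n × (Fin n → ℝ) →L[ℝ] ℂ :=
  ∑ k ∈ Finset.range n, (-weightAt n lam k) • Complex.ofRealCLM.comp
    (∑ j ∈ Finset.range (k + 1), logEntry n k j - ∑ j ∈ Finset.range k, logEntry n (k - 1) j)

/-- The weight `w_λ` in logarithmic coordinates. -/
noncomputable def expWeight (n : ℕ) (lam : Fin n → ℂ) (x : GTArray n × (Fin n → ℝ)) : ℂ :=
  Complex.exp (logWeight n lam x)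

theorem expWeight_mem (n : ℕ) (lam : Fin n → ℂ) :
    expWeight n lam ∈ expPoly (GTArray n × (Fin n → ℝ)) :=
  cexp_clm_mem_expPoly _

theorem wfun_exp (n : ℕ) (lam : Fin n → ℂ) (t : GTArray n) (h : Fin n → ℝ) :
    wfun n lam (fun i => Real.exp (h i)) (fun k j => Real.exp (t k j))
      = expWeight n lam (t, h) := by
  unfold wfun expWeight logWeight
  rw [sum_apply, Complex.exp_sum]
  refine Finset.prod_congr rfl fun k hk => ?_
  rw [Finset.mem_range] at hk
  have h1 : ∏ j ∈ Finset.range (k + 1),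
      Zent n (fun i => Real.exp (h i)) (fun k j => Real.exp (t k j)) k j
      = Real.exp (∑ j ∈ Finset.range (k + 1), logEntry n k j (t, h)) := by
    rw [Real.exp_sum]
    refine Finset.prod_congr rfl fun j hj => Zent_exp hk ?_ t h
    rw [Finset.mem_range] at hj
    omega
  have h2 : ∏ j ∈ Finset.range k,
      Zent n (fun i => Real.exp (h i)) (fun k j => Real.exp (t k j)) (k - 1) j
      = Real.exp (∑ j ∈ Finset.range k, logEntry n (k - 1) j (t, h)) := by
    rw [Real.exp_sum]
    refine Finset.prod_congr rfl fun j hj => ?_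
    rw [Finset.mem_range] at hj
    exact Zent_exp (by omega) (by omega) t h
  rw [h1, h2, ← Real.exp_sub, Real.log_exp]
  simp [weightAt]

/-- The derivative of the entrywise exponential of a triangular array. -/
noncomputable def expDeriv (n : ℕ) (t : GTArray n) : GTArray n →L[ℝ] GTArray n :=
  ContinuousLinearMap.pi fun k => ContinuousLinearMap.pi fun j =>
    Real.exp (t k j) •
      (ContinuousLinearMap.proj (R := ℝ) (φ := fun _ : Fin (k.1 + 1) => ℝ) j).comp
        (ContinuousLinearMap.proj (R := ℝ) (φ := fun k : Fin (n - 1) => Fin (k.1 + 1) → ℝ) k)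

theorem det_expDeriv (n : ℕ) (t : GTArray n) :
    (expDeriv n t).det = ∏ k : Fin (n - 1), ∏ j : Fin (k.1 + 1), Real.exp (t k j) := by
  let b := Pi.basis fun k : Fin (n - 1) => Pi.basisFun ℝ (Fin (k.1 + 1))
  have hm : LinearMap.toMatrix b b (expDeriv n t : GTArray n →ₗ[ℝ] GTArray n)
      = Matrix.diagonal fun p => Real.exp (t p.1 p.2) := by
    ext ⟨k, j⟩ ⟨k', j'⟩
    rw [LinearMap.toMatrix_apply, Pi.basis_apply, Pi.basis_repr, Pi.basisFun_repr,
      Pi.basisFun_apply]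
    simp only [expDeriv, ContinuousLinearMap.coe_coe, ContinuousLinearMap.coe_pi',
      smul_apply, ContinuousLinearMap.comp_apply, ContinuousLinearMap.proj_apply, smul_eq_mul,
      Matrix.diagonal_apply]
    by_cases e : k = k'
    · subst e
      simp [Pi.single_apply]
    · simp [e]
  rw [ContinuousLinearMap.det, ← LinearMap.det_toMatrix b, hm, Matrix.det_diagonal,
    Fintype.prod_sigma]

theorem hasFDerivAt_exp_entries (n : ℕ) (t : GTArray n) :
    HasFDerivAt (fun (t : GTArray n) k j => Real.exp (t k j)) (expDeriv n t) t := by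
  rw [hasFDerivAt_pi']
  intro k
  rw [hasFDerivAt_pi']
  intro j
  exact HasFDerivAt.exp (((ContinuousLinearMap.proj (R := ℝ) (φ := fun _ : Fin (k.1 + 1) => ℝ)
    j).comp (ContinuousLinearMap.proj (R := ℝ)
      (φ := fun k : Fin (n - 1) => Fin (k.1 + 1) → ℝ) k)).hasFDerivAt (x := t))

theorem setIntegral_GTpos_mul_GTdens (n : ℕ) (G : GTArray n → ℂ) :
    ∫ z in GTpos n, G z * (GTdens n z : ℂ) = ∫ t : GTArray n, G fun k j => Real.exp (t k j) := by
  have himg : GTpos n = (fun (t : GTArray n) k j => Real.exp (t k j)) '' Set.univ := by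
    ext z
    simp only [GTpos, Set.mem_ofPred_eq, Set.image_univ, Set.mem_range]
    constructor
    · intro hz
      exact ⟨fun k j => Real.log (z k j), by ext k j; exact Real.exp_log (hz k j)⟩
    · rintro ⟨t, rfl⟩ k j
      exact Real.exp_pos _
  rw [himg, integral_image_eq_integral_abs_det_fderiv_smul volume MeasurableSet.univ
    (fun t _ => (hasFDerivAt_exp_entries n t).hasFDerivWithinAt), setIntegral_univ]
  · refine integral_congr_ae (Filter.Eventually.of_forall fun t => ?_)
    have hp : 0 < ∏ k : Fin (n - 1), ∏ j : Fin (k.1 + 1), Real.exp (t k j) :=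
      Finset.prod_pos fun k _ => Finset.prod_pos fun j _ => Real.exp_pos _
    have hd : GTdens n (fun k j => Real.exp (t k j))
        = (∏ k : Fin (n - 1), ∏ j : Fin (k.1 + 1), Real.exp (t k j))⁻¹ := by
      simp [GTdens, Finset.prod_inv_distrib]
    simp only [det_expDeriv, abs_of_pos hp, hd, Complex.real_smul]
    rw [mul_left_comm, ← Complex.ofReal_mul, mul_inv_cancel₀ hp.ne']
    simp
  · intro s _ t _ hst
    ext k j
    exact Real.exp_injective (congrFun (congrFun hst k) j)

theorem Psi_exp_eq_weightedIntegral (n : ℕ) (lam : Fin n → ℂ) (h : Fin n → ℝ) :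
    Psi n lam (fun i => Real.exp (h i))
      = weightedIntegral volume (potential n) (expWeight n lam) h := by
  rw [Psi, setIntegral_GTpos_mul_GTdens n fun z =>
    wfun n lam (fun i => Real.exp (h i)) z * (Real.exp (-Ffun n (fun i => Real.exp (h i)) z) : ℂ)]
  simp only [weightedIntegral, wfun_exp, potential_apply, Complex.ofReal_exp, Complex.ofReal_neg]

end GelfandTsetlinCoordinates

section TodaIdentity

/-- The ratio `z_{k,j} / z_{k-1,j-1}` in logarithmic coordinates, zero if there is no such term. -/
noncomputable def diagAbove (n : ℕ) : ℕ → ℕ → GTArray n × (Fin n → ℝ) → ℂ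
  | k + 1, j + 1 => cexpOfReal (logDiag n k j)
  | _, _ => 0

/-- The ratio `z_{k-1,j} / z_{k,j}` in logarithmic coordinates, zero if there is no such term. -/
noncomputable def vertAbove (n : ℕ) : ℕ → ℕ → GTArray n × (Fin n → ℝ) → ℂ
  | k + 1, j => if j ≤ k then cexpOfReal (logVert n k j) else 0
  | 0, _ => 0

theorem diagAbove_mem (n k j : ℕ) : diagAbove n k j ∈ expPoly (GTArray n × (Fin n → ℝ)) := by
  unfold diagAbove
  split
  · exact cexpOfReal_mem _
  · exact zero_mem _

theorem vertAbove_mem (n k j : ℕ) : vertAbove n k j ∈ expPoly (GTArray n × (Fin n → ℝ)) := by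
  unfold vertAbove
  split
  · split_ifs
    · exact cexpOfReal_mem _
    · exact zero_mem _
  · exact zero_mem _

theorem const_mem_expPoly {X : Type*} [NormedAddCommGroup X] [NormedSpace ℝ X] (c : ℂ) :
    (fun _ : X => c) ∈ expPoly X :=
  algebraMap_mem (expPoly X) c

/-- The part of the logarithmic derivative of the integrand in the entry `(k, j)` that comes
from the row above it. -/
noncomputable def derivAbove (n : ℕ) (lam : Fin n → ℂ) (k j : ℕ) :
    GTArray n × (Fin n → ℝ) → ℂ :=
  (fun _ => -weightAt n lam k) - diagAbove n k j + vertAbove n k j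

/-- The part of the logarithmic derivative of the integrand in the entry `(k, j)` that comes
from the row below it. -/
noncomputable def derivBelow (n : ℕ) (lam : Fin n → ℂ) (k j : ℕ) :
    GTArray n × (Fin n → ℝ) → ℂ :=
  (fun _ => weightAt n lam (k + 1)) + cexpOfReal (logDiag n k j) - cexpOfReal (logVert n k j)

theorem derivAbove_mem (n : ℕ) (lam : Fin n → ℂ) (k j : ℕ) :
    derivAbove n lam k j ∈ expPoly (GTArray n × (Fin n → ℝ)) :=
  add_mem (sub_mem (const_mem_expPoly _) (diagAbove_mem n k j)) (vertAbove_mem n k j)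

theorem derivBelow_mem (n : ℕ) (lam : Fin n → ℂ) (k j : ℕ) :
    derivBelow n lam k j ∈ expPoly (GTArray n × (Fin n → ℝ)) :=
  sub_mem (add_mem (const_mem_expPoly _) (cexpOfReal_mem _)) (cexpOfReal_mem _)

theorem sum_range_sum_range_ite (N k j : ℕ) (hj : j ≤ k) (f : ℕ → ℕ → ℂ) :
    ∑ k' ∈ Finset.range N, ∑ j' ∈ Finset.range (k' + 1),
      (if k' = k ∧ j' = j then f k' j' else 0) = if k < N then f k j else 0 := by
  have h : ∀ k' ∈ Finset.range N, ∑ j' ∈ Finset.range (k' + 1),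
      (if k' = k ∧ j' = j then f k' j' else 0) = if k' = k then f k j else 0 := by
    intro k' _
    by_cases e : k' = k
    · subst e
      simp [Nat.lt_succ_of_le hj]
    · simp [e]
  rw [Finset.sum_congr rfl h]
  simp

theorem fderiv_diagAbove {n k j : ℕ} (hk : k < n) (hj : j ≤ k) (x : GTArray n × (Fin n → ℝ)) :
    fderiv ℝ (diagAbove n k j) x (entryDir n k j) = diagAbove n k j x := by
  match k, j with
  | k + 1, j + 1 =>
    have h : logDiag n k j (entryDir n (k + 1) (j + 1)) = 1 := by
      simp only [logDiag, sub_apply]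
      rw [logEntry_entryDir hk hj hk hj, logEntry_entryDir (by omega) (by omega) hk hj]
      simp
    simp [diagAbove, fderiv_cexpOfReal, h]
  | 0, j => simp [diagAbove]
  | k + 1, 0 => simp [diagAbove]

theorem fderiv_vertAbove {n k j : ℕ} (hk : k < n) (hj : j ≤ k) (x : GTArray n × (Fin n → ℝ)) :
    fderiv ℝ (vertAbove n k j) x (entryDir n k j) = -vertAbove n k j x := by
  match k with
  | k + 1 =>
    by_cases hjk : j ≤ k
    · have h : logVert n k j (entryDir n (k + 1) j) = -1 := by
        simp only [logVert, sub_apply]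
        rw [logEntry_entryDir hk hj hk hj, logEntry_entryDir (by omega) (by omega) hk hj]
        simp
      simp [vertAbove, hjk, fderiv_cexpOfReal, h]
    · simp [vertAbove, hjk]
  | 0 => simp [vertAbove]

theorem fderiv_derivAbove {n k j : ℕ} (lam : Fin n → ℂ) (hk : k < n) (hj : j ≤ k)
    (x : GTArray n × (Fin n → ℝ)) :
    fderiv ℝ (derivAbove n lam k j) x (entryDir n k j)
      = -diagAbove n k j x - vertAbove n k j x := by
  have h1 := (differentiable_of_mem_expPoly (diagAbove_mem n k j) x).hasFDerivAt
  have h2 := (differentiable_of_mem_expPoly (vertAbove_mem n k j) x).hasFDerivAt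
  have h : HasFDerivAt (derivAbove n lam k j) _ x :=
    ((hasFDerivAt_const (-weightAt n lam k) x).sub h1).add h2
  rw [h.fderiv]
  simp only [zero_sub, add_apply, neg_apply, fderiv_diagAbove hk hj, fderiv_vertAbove hk hj]
  ring

theorem fderiv_derivBelow {n k j : ℕ} (lam : Fin n → ℂ) (hk : k < n - 1) (hj : j ≤ k)
    (x : GTArray n × (Fin n → ℝ)) :
    fderiv ℝ (derivBelow n lam k j) x (entryDir n k j)
      = -cexpOfReal (logDiag n k j) x - cexpOfReal (logVert n k j) x := by
  have h1 := (differentiable_of_mem_expPoly (cexpOfReal_mem (logDiag n k j)) x).hasFDerivAt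
  have h2 := (differentiable_of_mem_expPoly (cexpOfReal_mem (logVert n k j)) x).hasFDerivAt
  have h : HasFDerivAt (derivBelow n lam k j) _ x :=
    ((hasFDerivAt_const (weightAt n lam (k + 1)) x).add h1).sub h2
  have hd : logDiag n k j (entryDir n k j) = -1 := by
    simp only [logDiag, sub_apply]
    rw [logEntry_entryDir (by omega) (by omega) (by omega) hj,
      logEntry_entryDir (by omega) hj (by omega) hj]
    simp
  have hv : logVert n k j (entryDir n k j) = 1 := by
    simp only [logVert, sub_apply]
    rw [logEntry_entryDir (by omega) (by omega) (by omega) hj,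
      logEntry_entryDir (by omega) (by omega) (by omega) hj]
    simp
  rw [h.fderiv]
  simp only [zero_add, sub_apply, fderiv_cexpOfReal, hd, hv]
  push_cast
  ring

theorem fderiv_potential_entryDir {n k j : ℕ} (hk : k < n) (hj : j ≤ k)
    (x : GTArray n × (Fin n → ℝ)) :
    fderiv ℝ (potential n) x (entryDir n k j) = diagAbove n k j x - vertAbove n k j x
      - if k < n - 1 then cexpOfReal (logDiag n k j) x - cexpOfReal (logVert n k j) x else 0 := by
  have h : HasFDerivAt (potential n) (∑ k ∈ Finset.range (n - 1), ∑ j ∈ Finset.range (k + 1),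
      (fderiv ℝ (cexpOfReal (logDiag n k j)) x + fderiv ℝ (cexpOfReal (logVert n k j)) x)) x :=
    HasFDerivAt.sum fun k _ => HasFDerivAt.sum fun j _ =>
      (differentiable_of_mem_expPoly (cexpOfReal_mem _) x).hasFDerivAt.add
        (differentiable_of_mem_expPoly (cexpOfReal_mem _) x).hasFDerivAt
  rw [h.fderiv]
  simp only [sum_apply, add_apply, fderiv_cexpOfReal]
  have split : ∀ k' ∈ Finset.range (n - 1), ∀ j' ∈ Finset.range (k' + 1),
      (logDiag n k' j' (entryDir n k j) : ℂ) * cexpOfReal (logDiag n k' j') x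
        + (logVert n k' j' (entryDir n k j) : ℂ) * cexpOfReal (logVert n k' j') x
      = (if k' + 1 = k ∧ j' + 1 = j then cexpOfReal (logDiag n k' j') x else 0)
        - (if k' + 1 = k ∧ j' = j then cexpOfReal (logVert n k' j') x else 0)
        - (if k' = k ∧ j' = j then cexpOfReal (logDiag n k' j') x
            - cexpOfReal (logVert n k' j') x else 0) := by
    intro k' hk' j' hj'
    rw [Finset.mem_range] at hk' hj'
    simp only [logDiag, logVert, sub_apply]
    rw [logEntry_entryDir (by omega) (by omega) hk hj,
      logEntry_entryDir (by omega) (by omega) hk hj,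
      logEntry_entryDir (by omega) (by omega) hk hj]
    split_ifs <;> push_cast <;> ring
  rw [Finset.sum_congr rfl fun k' hk' => Finset.sum_congr rfl (split k' hk')]
  simp only [Finset.sum_sub_distrib]
  rw [sum_range_sum_range_ite (n - 1) k j hj
    fun k' j' => cexpOfReal (logDiag n k' j') x - cexpOfReal (logVert n k' j') x]
  congr 2
  · match k, j with
    | k + 1, j + 1 =>
      simp only [Nat.add_right_cancel_iff]
      rw [sum_range_sum_range_ite (n - 1) k j (by omega) fun k' j' => cexpOfReal (logDiag n k' j') x,
        if_pos (by omega)]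
      rfl
    | 0, j => simp [diagAbove]
    | k + 1, 0 => simp [diagAbove]
  · match k with
    | k + 1 =>
      simp only [Nat.add_right_cancel_iff]
      by_cases hjk : j ≤ k
      · rw [sum_range_sum_range_ite (n - 1) k j hjk fun k' j' => cexpOfReal (logVert n k' j') x,
          if_pos (by omega)]
        simp [vertAbove, hjk]
      · simp only [vertAbove, hjk, if_false, Pi.zero_apply]
        refine Finset.sum_eq_zero fun k' _ => Finset.sum_eq_zero fun j' hj' => ?_
        rw [Finset.mem_range] at hj'
        rw [if_neg (by omega)]
    | 0 => simp [vertAbove]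

theorem logWeight_entryDir {n k j : ℕ} (lam : Fin n → ℂ) (hk : k < n) (hj : j ≤ k) :
    logWeight n lam (entryDir n k j)
      = -weightAt n lam k + if k < n - 1 then weightAt n lam (k + 1) else 0 := by
  have e1 : ∀ k' ∈ Finset.range n,
      ∑ j' ∈ Finset.range (k' + 1), logEntry n k' j' (entryDir n k j)
        = if k' = k then 1 else 0 := by
    intro k' hk'
    rw [Finset.mem_range] at hk'
    have : ∀ j' ∈ Finset.range (k' + 1), logEntry n k' j' (entryDir n k j)
        = if k' = k ∧ j' = j then 1 else 0 := fun j' hj' =>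
      logEntry_entryDir hk' (Nat.lt_succ_iff.1 (Finset.mem_range.1 hj')) hk hj
    rw [Finset.sum_congr rfl this]
    by_cases e : k' = k
    · subst e
      simp [Nat.lt_succ_of_le hj]
    · simp [e]
  have e2 : ∀ k' ∈ Finset.range n,
      ∑ j' ∈ Finset.range k', logEntry n (k' - 1) j' (entryDir n k j)
        = if k' = k + 1 then 1 else 0 := by
    intro k' hk'
    rw [Finset.mem_range] at hk'
    match k' with
    | 0 => simp
    | k' + 1 =>
      have : ∀ j' ∈ Finset.range (k' + 1), logEntry n k' j' (entryDir n k j)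
          = if k' = k ∧ j' = j then 1 else 0 := fun j' hj' =>
        logEntry_entryDir (by omega) (Nat.lt_succ_iff.1 (Finset.mem_range.1 hj')) hk hj
      rw [Nat.add_sub_cancel, Finset.sum_congr rfl this]
      by_cases e : k' = k
      · subst e
        simp [Nat.lt_succ_of_le hj]
      · simp [e]
  have e3 : logWeight n lam (entryDir n k j) = ∑ k' ∈ Finset.range n,
      ((if k' = k then -weightAt n lam k' else 0)
        + if k' = k + 1 then weightAt n lam k' else 0) := by
    simp only [logWeight, sum_apply]
    refine Finset.sum_congr rfl fun k' hk' => ?_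
    simp only [smul_apply, ContinuousLinearMap.comp_apply, sub_apply, sum_apply, e1 k' hk',
      e2 k' hk', Complex.ofRealCLM_apply, smul_eq_mul]
    split_ifs <;> push_cast <;> ring
  rw [e3, Finset.sum_add_distrib]
  have h1 : k + 1 < n ↔ k < n - 1 := by omega
  simp [hk, h1]

theorem logWeight_sub_fderiv_potential {n k j : ℕ} (lam : Fin n → ℂ) (hk : k < n) (hj : j ≤ k)
    (x : GTArray n × (Fin n → ℝ)) :
    logWeight n lam (entryDir n k j) - fderiv ℝ (potential n) x (entryDir n k j)
      = derivAbove n lam k j x + if k < n - 1 then derivBelow n lam k j x else 0 := by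
  rw [logWeight_entryDir lam hk hj, fderiv_potential_entryDir hk hj]
  simp only [derivAbove, derivBelow, Pi.add_apply, Pi.sub_apply]
  split_ifs <;> ring

theorem twistedDeriv_expWeight_mul {n : ℕ} (lam : Fin n → ℂ)
    {q : GTArray n × (Fin n → ℝ) → ℂ} (hq : q ∈ expPoly (GTArray n × (Fin n → ℝ)))
    (v x : GTArray n × (Fin n → ℝ)) :
    twistedDeriv (potential n) v (expWeight n lam * q) x
      = expWeight n lam x * (fderiv ℝ q x v
        + q x * (logWeight n lam v - fderiv ℝ (potential n) x v)) := by
  have h : HasFDerivAt (expWeight n lam) _ x := (logWeight n lam).hasFDerivAt.cexp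
  have hm := h.mul (differentiable_of_mem_expPoly hq x).hasFDerivAt
  rw [twistedDeriv, hm.fderiv]
  simp only [add_apply, smul_apply, smul_eq_mul, Pi.mul_apply, expWeight]
  ring

/-- The part of the squared logarithmic gradient in row `k`, including second derivatives,
that comes from the row above. -/
noncomputable def rowAbove (n : ℕ) (lam : Fin n → ℂ) (k : ℕ) : GTArray n × (Fin n → ℝ) → ℂ :=
  ∑ j ∈ Finset.range (k + 1), (derivAbove n lam k j ^ 2 - diagAbove n k j - vertAbove n k j)

/-- The part of the squared logarithmic gradient in row `k`, including second derivatives,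
that comes from the row below. -/
noncomputable def rowBelow (n : ℕ) (lam : Fin n → ℂ) (k : ℕ) : GTArray n × (Fin n → ℝ) → ℂ :=
  ∑ j ∈ Finset.range (k + 1),
    (derivBelow n lam k j ^ 2 - cexpOfReal (logDiag n k j) - cexpOfReal (logVert n k j))

/-- The Toda potential of row `k`. -/
noncomputable def todaPotential (n k : ℕ) : GTArray n × (Fin n → ℝ) → ℂ :=
  ∑ j ∈ Finset.range k, cexpOfReal (logEntry n k (j + 1) - logEntry n k j)

theorem rowAbove_mem (n : ℕ) (lam : Fin n → ℂ) (k : ℕ) :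
    rowAbove n lam k ∈ expPoly (GTArray n × (Fin n → ℝ)) :=
  sum_mem fun _ _ => sub_mem (sub_mem (pow_mem (derivAbove_mem _ _ _ _) _) (diagAbove_mem _ _ _))
    (vertAbove_mem _ _ _)

theorem rowBelow_mem (n : ℕ) (lam : Fin n → ℂ) (k : ℕ) :
    rowBelow n lam k ∈ expPoly (GTArray n × (Fin n → ℝ)) :=
  sum_mem fun _ _ => sub_mem (sub_mem (pow_mem (derivBelow_mem _ _ _ _) _) (cexpOfReal_mem _))
    (cexpOfReal_mem _)

theorem todaPotential_mem (n k : ℕ) :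
    todaPotential n k ∈ expPoly (GTArray n × (Fin n → ℝ)) :=
  sum_mem fun _ _ => cexpOfReal_mem _

theorem sum_sq_interlacing (m : ℕ) (l : ℂ) (a b A B : ℕ → ℂ) (hA0 : A 0 = 0)
    (hA : ∀ j, A (j + 1) = a j) (hB : ∀ j ≤ m, B j = b j) (hBm : B (m + 1) = 0) :
    ∑ j ∈ Finset.range (m + 2), ((-l - A j + B j) ^ 2 - A j - B j)
      = ∑ j ∈ Finset.range (m + 1), ((l + a j - b j) ^ 2 - a j - b j) + l ^ 2
        + 2 * ∑ j ∈ Finset.range (m + 1), a j * b j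
        - 2 * ∑ j ∈ Finset.range m, a j * b (j + 1) := by
  have hB' : ∀ φ : ℂ → ℂ, ∑ j ∈ Finset.range (m + 1), φ (B j)
      = ∑ j ∈ Finset.range (m + 1), φ (b j) := fun φ =>
    Finset.sum_congr rfl fun j hj => by
      rw [hB j (Nat.lt_succ_iff.1 (Finset.mem_range.1 hj))]
  have e1 : ∑ j ∈ Finset.range (m + 2), (A j ^ 2 + 2 * l * A j - A j)
      = ∑ j ∈ Finset.range (m + 1), (a j ^ 2 + 2 * l * a j - a j) := by
    rw [Finset.sum_range_succ']
    simp [hA0, hA]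
  have e2 : ∑ j ∈ Finset.range (m + 2), (B j ^ 2 - 2 * l * B j - B j)
      = ∑ j ∈ Finset.range (m + 1), (b j ^ 2 - 2 * l * b j - b j) := by
    rw [Finset.sum_range_succ, hBm, hB' fun z => z ^ 2 - 2 * l * z - z]
    simp
  have e3 : ∑ j ∈ Finset.range (m + 2), A j * B j
      = ∑ j ∈ Finset.range m, a j * b (j + 1) := by
    rw [Finset.sum_range_succ', Finset.sum_range_succ, hA0, hBm]
    simp only [hA, mul_zero, zero_mul, add_zero]
    exact Finset.sum_congr rfl fun j hj => by rw [hB _ (Finset.mem_range.1 hj)]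
  have l1 : ∑ j ∈ Finset.range (m + 2), ((-l - A j + B j) ^ 2 - A j - B j)
      = (m + 2) * l ^ 2 + ∑ j ∈ Finset.range (m + 2), (A j ^ 2 + 2 * l * A j - A j)
        + ∑ j ∈ Finset.range (m + 2), (B j ^ 2 - 2 * l * B j - B j)
        - 2 * ∑ j ∈ Finset.range (m + 2), A j * B j := by
    have hc : ((m : ℂ) + 2) * l ^ 2 = ∑ j ∈ Finset.range (m + 2), l ^ 2 := by simp
    rw [hc, Finset.mul_sum, ← Finset.sum_add_distrib, ← Finset.sum_add_distrib,
      ← Finset.sum_sub_distrib]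
    exact Finset.sum_congr rfl fun j _ => by ring
  have l2 : ∑ j ∈ Finset.range (m + 1), ((l + a j - b j) ^ 2 - a j - b j)
      = (m + 1) * l ^ 2 + ∑ j ∈ Finset.range (m + 1), (a j ^ 2 + 2 * l * a j - a j)
        + ∑ j ∈ Finset.range (m + 1), (b j ^ 2 - 2 * l * b j - b j)
        - 2 * ∑ j ∈ Finset.range (m + 1), a j * b j := by
    have hc : ((m : ℂ) + 1) * l ^ 2 = ∑ j ∈ Finset.range (m + 1), l ^ 2 := by simp
    rw [hc, Finset.mul_sum, ← Finset.sum_add_distrib, ← Finset.sum_add_distrib,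
      ← Finset.sum_sub_distrib]
    exact Finset.sum_congr rfl fun j _ => by ring
  rw [l1, l2, e1, e2, e3]
  ring

theorem rowAbove_succ (n : ℕ) (lam : Fin n → ℂ) (k : ℕ) :
    rowAbove n lam (k + 1) = rowBelow n lam k + ((fun _ => weightAt n lam (k + 1) ^ 2)
      + 2 * todaPotential n (k + 1) - 2 * todaPotential n k) := by
  ext x
  have h := sum_sq_interlacing k (weightAt n lam (k + 1))
    (fun j => cexpOfReal (logDiag n k j) x) (fun j => cexpOfReal (logVert n k j) x)
    (fun j => diagAbove n (k + 1) j x) (fun j => vertAbove n (k + 1) j x)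
    rfl (fun _ => rfl) (fun j hj => by simp [vertAbove, hj]) (by simp [vertAbove])
  have v1 : ∀ j, cexpOfReal (logDiag n k j) x * cexpOfReal (logVert n k j) x
      = cexpOfReal (logEntry n (k + 1) (j + 1) - logEntry n (k + 1) j) x := by
    intro j
    rw [cexpOfReal, cexpOfReal, ← Complex.exp_add]
    simp [cexpOfReal, logDiag, logVert]
  have v2 : ∀ j, cexpOfReal (logDiag n k j) x * cexpOfReal (logVert n k (j + 1)) x
      = cexpOfReal (logEntry n k (j + 1) - logEntry n k j) x := by
    intro j
    rw [cexpOfReal, cexpOfReal, ← Complex.exp_add]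
    simp only [cexpOfReal, logDiag, logVert, ContinuousLinearMap.comp_apply, sub_apply,
      Complex.ofRealCLM_apply]
    push_cast
    ring_nf
  simp only [v1, v2] at h
  simp only [rowAbove, rowBelow, todaPotential, derivAbove, derivBelow, Finset.sum_apply,
    Pi.add_apply, Pi.sub_apply, Pi.mul_apply, Pi.pow_apply, Pi.ofNat_apply]
  rw [h]
  ring

theorem rowAbove_zero (n : ℕ) (lam : Fin n → ℂ) :
    rowAbove n lam 0 = fun _ => weightAt n lam 0 ^ 2 := by
  ext x
  simp [rowAbove, derivAbove, diagAbove, vertAbove]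

theorem weightedIntegral_rowBelow {n k : ℕ} (lam : Fin n → ℂ) (hk : k < n - 1)
    (h : Fin n → ℝ) :
    weightedIntegral volume (potential n) (expWeight n lam * rowBelow n lam k) h
      = weightedIntegral volume (potential n) (expWeight n lam * rowAbove n lam k) h := by
  have hU := potential_mem n
  have hE := expWeight_mem n lam
  have e : expWeight n lam * rowBelow n lam k - expWeight n lam * rowAbove n lam k
      = ∑ j ∈ Finset.range (k + 1), twistedDeriv (potential n) (entryDir n k j)
          (expWeight n lam * (derivBelow n lam k j - derivAbove n lam k j)) := by
    rw [← mul_sub, rowBelow, rowAbove, ← Finset.sum_sub_distrib, Finset.mul_sum]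
    refine Finset.sum_congr rfl fun j hj => ?_
    have hj' : j ≤ k := Nat.lt_succ_iff.1 (Finset.mem_range.1 hj)
    have hk' : k < n := by omega
    ext x
    rw [twistedDeriv_expWeight_mul lam (sub_mem (derivBelow_mem _ _ _ _) (derivAbove_mem _ _ _ _)),
      logWeight_sub_fderiv_potential lam hk' hj',
      fderiv_sub (differentiable_of_mem_expPoly (derivBelow_mem _ _ _ _) x)
        (differentiable_of_mem_expPoly (derivAbove_mem _ _ _ _) x), sub_apply,
      fderiv_derivBelow lam hk hj', fderiv_derivAbove lam hk' hj', if_pos hk]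
    simp only [Pi.mul_apply, Pi.sub_apply, Pi.pow_apply]
    ring
  have hmem : ∀ j, expWeight n lam * (derivBelow n lam k j - derivAbove n lam k j)
      ∈ expPoly (GTArray n × (Fin n → ℝ)) := fun j =>
    mul_mem hE (sub_mem (derivBelow_mem _ _ _ _) (derivAbove_mem _ _ _ _))
  rw [← sub_eq_zero, ← weightedIntegral_sub hU (expCoercive_potential n)
    (mul_mem hE (rowBelow_mem _ _ _)) (mul_mem hE (rowAbove_mem _ _ _)), e,
    weightedIntegral_sum _ hU (expCoercive_potential n)
      fun j _ => twistedDeriv_mem hU (hmem j) _]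
  refine Finset.sum_eq_zero fun j hj => ?_
  have hd : entryDir n k j
      = (Pi.single ⟨k, hk⟩ (Pi.single ⟨j, Finset.mem_range.1 hj⟩ 1), 0) := by
    simp [entryDir, hk, Finset.mem_range.1 hj]
  rw [hd]
  exact weightedIntegral_twistedDeriv_fst hU (expCoercive_potential n) (hmem j) _ h

theorem weightedIntegral_rowAbove {n k : ℕ} (lam : Fin n → ℂ) (hk : k < n) (h : Fin n → ℝ) :
    weightedIntegral volume (potential n) (expWeight n lam * rowAbove n lam k) h
      = weightedIntegral volume (potential n) (expWeight n lam *
        ((fun _ => ∑ i ∈ Finset.range (k + 1), weightAt n lam i ^ 2)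
          + 2 * todaPotential n k)) h := by
  have hU := potential_mem n
  have hc := expCoercive_potential n
  have hE := expWeight_mem n lam
  have two_mem : ∀ k, 2 * todaPotential n k ∈ expPoly (GTArray n × (Fin n → ℝ)) := fun k =>
    mul_mem (ofNat_mem _ 2) (todaPotential_mem n k)
  induction k with
  | zero =>
    rw [rowAbove_zero]
    simp [todaPotential]
  | succ k ih =>
    have hm : (fun _ => weightAt n lam (k + 1) ^ 2)
      + 2 * todaPotential n (k + 1) - 2 * todaPotential n k
        ∈ expPoly (GTArray n × (Fin n → ℝ)) :=
      sub_mem (add_mem (const_mem_expPoly _) (two_mem _)) (two_mem _)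
    rw [rowAbove_succ, mul_add, weightedIntegral_add hU hc (mul_mem hE (rowBelow_mem _ _ _))
      (mul_mem hE hm), weightedIntegral_rowBelow lam (by omega), ih (by omega),
      ← weightedIntegral_add hU hc
        (mul_mem hE (add_mem (const_mem_expPoly _) (two_mem _))) (mul_mem hE hm)]
    congr 1
    ext x
    simp only [Pi.mul_apply, Pi.add_apply, Pi.sub_apply, Finset.sum_range_succ _ (k + 1)]
    ring

theorem twistedDeriv_expWeight_last {n j : ℕ} (lam : Fin n → ℂ) (hj : j < n) :
    twistedDeriv (potential n) (0, Pi.single ⟨j, hj⟩ 1) (expWeight n lam)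
      = expWeight n lam * derivAbove n lam (n - 1) j := by
  have hd : entryDir n (n - 1) j = (0, Pi.single ⟨j, hj⟩ 1) := by simp [entryDir, hj]
  ext x
  have h := twistedDeriv_expWeight_mul lam (one_mem (expPoly (GTArray n × (Fin n → ℝ))))
    (entryDir n (n - 1) j) x
  rw [logWeight_sub_fderiv_potential lam (by omega) (by omega), if_neg (lt_irrefl _), mul_one,
    hd] at h
  rw [h]
  have h1 : (1 : GTArray n × (Fin n → ℝ) → ℂ) = fun _ => 1 := rfl
  simp [h1]

theorem twistedDeriv_expWeight_mul_derivAbove_last {n j : ℕ} (lam : Fin n → ℂ) (hj : j < n) :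
    twistedDeriv (potential n) (0, Pi.single ⟨j, hj⟩ 1)
        (expWeight n lam * derivAbove n lam (n - 1) j)
      = expWeight n lam
        * (derivAbove n lam (n - 1) j ^ 2 - diagAbove n (n - 1) j - vertAbove n (n - 1) j) := by
  have hd : entryDir n (n - 1) j = (0, Pi.single ⟨j, hj⟩ 1) := by simp [entryDir, hj]
  ext x
  rw [← hd, twistedDeriv_expWeight_mul lam (derivAbove_mem _ _ _ _),
    logWeight_sub_fderiv_potential lam (by omega) (by omega), if_neg (lt_irrefl _),
    fderiv_derivAbove lam (by omega) (by omega)]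
  simp only [Pi.mul_apply, Pi.sub_apply, Pi.pow_apply]
  ring

theorem laplacian_weightedIntegral {n : ℕ} (hn : 1 ≤ n) (lam : Fin n → ℂ) (h : Fin n → ℝ) :
    ∑ i : Fin n, fderiv ℝ (fun y => fderiv ℝ
        (weightedIntegral volume (potential n) (expWeight n lam)) y (Pi.single i 1))
        h (Pi.single i 1)
      = weightedIntegral volume (potential n) (expWeight n lam * rowAbove n lam (n - 1)) h := by
  have hU := potential_mem n
  have hc := expCoercive_potential n
  have hE := expWeight_mem n lam
  have hterm : ∀ i : Fin n, fderiv ℝ (fun y => fderiv ℝ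
        (weightedIntegral volume (potential n) (expWeight n lam)) y (Pi.single i 1))
        h (Pi.single i 1)
      = weightedIntegral volume (potential n) (expWeight n lam
        * (derivAbove n lam (n - 1) i ^ 2 - diagAbove n (n - 1) i - vertAbove n (n - 1) i)) h := by
    intro i
    simp only [fderiv_weightedIntegral hU hc hE]
    rw [twistedDeriv_expWeight_last lam i.2]
    refine (fderiv_weightedIntegral hU hc (mul_mem hE (derivAbove_mem _ _ _ _)) h _).trans ?_
    rw [twistedDeriv_expWeight_mul_derivAbove_last lam i.2]
  rw [Finset.sum_congr rfl fun i _ => hterm i,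
    Fin.sum_univ_eq_sum_range (fun i => weightedIntegral volume (potential n) (expWeight n lam
      * (derivAbove n lam (n - 1) i ^ 2 - diagAbove n (n - 1) i - vertAbove n (n - 1) i)) h) n,
    rowAbove, Finset.mul_sum, weightedIntegral_sum _ hU hc, Nat.sub_add_cancel hn]
  exact fun i _ => mul_mem hE (sub_mem (sub_mem (pow_mem (derivAbove_mem _ _ _ _) _)
    (diagAbove_mem _ _ _)) (vertAbove_mem _ _ _))

theorem todaPotential_last {n : ℕ} (t : GTArray n) (h : Fin n → ℝ) :
    todaPotential n (n - 1) (t, h)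
      = ((∑ i ∈ Finset.range (n - 1),
          Real.exp ((if hi : i + 1 < n then h ⟨i + 1, hi⟩ else 0) -
            (if hi : i < n then h ⟨i, hi⟩ else 0)) : ℝ) : ℂ) := by
  simp [todaPotential, cexpOfReal_apply, logEntry_apply, Zent]

end TodaIdentity

/-- Theorem 1.1/4.2 made explicit for `G = GL(n)` via the Gelfand–Tsetlin integral
(eq:tableau): `f(h) = Ψⁿ_λ(e^{h₁},…,e^{hₙ})` is smooth and is an eigenfunction of
the quantum Toda Hamiltonian `H = ½Δ − Σ_{i} e^{h_{i+1}−h_i}` with eigenvalue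
`½ Σᵢ λᵢ²`. -/
theorem whittaker_is_toda_eigenfunction (n : ℕ) (hn : 1 ≤ n) (lam : Fin n → ℂ) :
    ContDiff ℝ (⊤ : ℕ∞) (fun h : Fin n → ℝ => Psi n lam fun i => Real.exp (h i)) ∧
      ∀ h : Fin n → ℝ,
        (1 / 2) * (∑ i : Fin n,
            fderiv ℝ
              (fun y : Fin n → ℝ =>
                fderiv ℝ (fun h' : Fin n → ℝ => Psi n lam fun i => Real.exp (h' i))
                  y (Pi.single i 1))
              h (Pi.single i 1))
          - ((∑ i ∈ Finset.range (n - 1),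
              Real.exp ((if hi : i + 1 < n then h ⟨i + 1, hi⟩ else 0) -
                (if hi : i < n then h ⟨i, hi⟩ else 0)) : ℝ) : ℂ) *
            Psi n lam (fun i => Real.exp (h i)) =
        (1 / 2) * ((∑ i : Fin n, (lam i) ^ 2)) *
          Psi n lam (fun i => Real.exp (h i)) := by
  have hfun : (fun h : Fin n → ℝ => Psi n lam fun i => Real.exp (h i))
      = weightedIntegral volume (potential n) (expWeight n lam) :=
    funext fun h => Psi_exp_eq_weightedIntegral n lam h
  rw [hfun]
  refine ⟨contDiff_weightedIntegral (potential_mem n) (expCoercive_potential n)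
    (expWeight_mem n lam), fun h => ?_⟩
  rw [laplacian_weightedIntegral hn, weightedIntegral_rowAbove lam (by omega),
    Psi_exp_eq_weightedIntegral, Nat.sub_add_cancel hn]
  have hs : ∑ i ∈ Finset.range n, weightAt n lam i ^ 2 = ∑ i : Fin n, lam i ^ 2 := by
    rw [← Fin.sum_univ_eq_sum_range]
    simp [weightAt]
  have hI : ∀ c V : ℂ, (∀ t, todaPotential n (n - 1) (t, h) = V) →
      weightedIntegral volume (potential n) (expWeight n lam *
        ((fun _ => c) + 2 * todaPotential n (n - 1))) h
      = (c + 2 * V) * weightedIntegral volume (potential n) (expWeight n lam) h := by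
    intro c V hV
    simp only [weightedIntegral, Pi.mul_apply, Pi.add_apply, Pi.ofNat_apply, hV]
    rw [← integral_const_mul]
    congr 1
    ext t
    ring
  rw [hI _ _ fun t => todaPotential_last t h, hs]
  ring
end

section
/- Let n ≥ 1, s > 0, and λ, ν ∈ ℂⁿ with Re(λᵢ + νⱼ) > 0 for all 1 ≤ i, j ≤ n. Then the function x ↦ e^{−s/xₙ} Ψⁿ_ν(x) Ψⁿ_λ(x) Π_{i=1}^n xᵢ^{−1} is absolutely integrable on ℝ_{>0}ⁿ, and ∫_{ℝ_{>0}ⁿ} e^{−s/xₙ} Ψⁿ_ν(x) Ψⁿ_λ(x) Π_{i=1}^n dxᵢ/xᵢ = s^{−Σ_{i=1}^n (νᵢ + λᵢ)} Π_{i=1}^n Π_{j=1}^n Γ(νᵢ + λⱼ), where Γ is the complex Gamma function and s^{−z} := exp(−z·log s). (This is the Cauchy-type identity for Whittaker functions, Theorem 5.3, first proved by Stade.) -/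
open MeasureTheory
open scoped BigOperators

section algebra

/-- The sum of the entries of `t` directly above and to the left of `(a, b)`, with the convention
that it is `s` at the corner `(0, 0)`. -/
def numer (s : ℝ) (t : ℕ × ℕ → ℝ) : ℕ → ℕ → ℝ
  | 0, 0 => s
  | 0, b + 1 => t (0, b)
  | a + 1, 0 => t (a, 0)
  | a + 1, b + 1 => t (a, b + 1) + t (a + 1, b)

/-- The product of the entries of `t` strictly above `(a, b)` on its diagonal. -/
def diagProd (t : ℕ × ℕ → ℝ) : ℕ → ℕ → ℝ
  | 0, _ => 1
  | _ + 1, 0 => 1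
  | a + 1, b + 1 => t (a, b) * diagProd t a b

/-- The local geometric toggle at the cell `(a, b)`. -/
noncomputable def toggle (s : ℝ) (a b : ℕ) (t : ℕ × ℕ → ℝ) : ℕ × ℕ → ℝ :=
  Function.update t (a, b)
    (numer s t a b / ((1 / t (a + 1, b) + 1 / t (a, b + 1)) * t (a, b)))

/-- The insertion of the newly added cell `(a, b)`. -/
noncomputable def grow (s : ℝ) (a b : ℕ) (t : ℕ × ℕ → ℝ) : ℕ × ℕ → ℝ :=
  Function.update t (a, b) (numer s t a b * t (a, b))

/-- Toggle the cells strictly above `(a, b)` on its diagonal, from the bottom up. -/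
noncomputable def sweep (s : ℝ) : ℕ → ℕ → (ℕ × ℕ → ℝ) → ℕ × ℕ → ℝ
  | a + 1, b + 1, t => sweep s a b (toggle s a b t)
  | 0, _, t => t
  | _ + 1, 0, t => t

/-- The energy of an array on a set of cells; it is invariant under toggles. -/
noncomputable def energy (s : ℝ) (S : Finset (ℕ × ℕ)) (t : ℕ × ℕ → ℝ) : ℝ :=
  ∑ p ∈ S, numer s t p.1 p.2 / t p

lemma numer_pos {s : ℝ} (hs : 0 < s) {t : ℕ × ℕ → ℝ} (ht : ∀ p, 0 < t p) (a b : ℕ) :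
    0 < numer s t a b := by
  rcases a with _ | a <;> rcases b with _ | b <;> simp only [numer]
  · exact hs
  · exact ht _
  · exact ht _
  · exact add_pos (ht _) (ht _)

lemma diagProd_zero_right (t : ℕ × ℕ → ℝ) (a : ℕ) : diagProd t a 0 = 1 := by
  rcases a with _ | a <;> rfl

lemma numer_congr (s : ℝ) {t t' : ℕ × ℕ → ℝ} (a b : ℕ)
    (h : ∀ p : ℕ × ℕ, (p.1 + 1 = a ∧ p.2 = b) ∨ (p.1 = a ∧ p.2 + 1 = b) → t p = t' p) :
    numer s t a b = numer s t' a b := by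
  rcases a with _ | a <;> rcases b with _ | b <;> simp only [numer]
  · exact h _ (by simp)
  · exact h _ (by simp)
  · rw [h (a, b + 1) (by simp), h (a + 1, b) (by simp)]

lemma diagProd_congr {t t' : ℕ × ℕ → ℝ} (a b : ℕ)
    (h : ∀ p : ℕ × ℕ, p.1 < a → p.1 + b = p.2 + a → t p = t' p) :
    diagProd t a b = diagProd t' a b := by
  induction a generalizing b with
  | zero => simp [diagProd]
  | succ a ih =>
    rcases b with _ | b
    · simp [diagProd]
    · simp only [diagProd]
      rw [h (a, b) (by simp) (by simp; omega),
        ih b (fun p h1 h2 => h p (by omega) (by omega))]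

lemma toggle_apply_of_ne (s : ℝ) (a b : ℕ) (t : ℕ × ℕ → ℝ) {p : ℕ × ℕ} (hp : p ≠ (a, b)) :
    toggle s a b t p = t p := by
  simp [toggle, Function.update_of_ne hp]

lemma grow_apply_of_ne (s : ℝ) (a b : ℕ) (t : ℕ × ℕ → ℝ) {p : ℕ × ℕ} (hp : p ≠ (a, b)) :
    grow s a b t p = t p := by
  simp [grow, Function.update_of_ne hp]

lemma toggle_pos {s : ℝ} (hs : 0 < s) {t : ℕ × ℕ → ℝ} (ht : ∀ p, 0 < t p) (a b : ℕ)
    (p : ℕ × ℕ) : 0 < toggle s a b t p := by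
  by_cases hp : p = (a, b)
  · subst hp
    have := numer_pos hs ht a b
    have := ht (a, b)
    have := ht (a + 1, b)
    have := ht (a, b + 1)
    simp only [toggle, Function.update_self]
    positivity
  · rw [toggle_apply_of_ne _ _ _ _ hp]; exact ht p

lemma grow_pos {s : ℝ} (hs : 0 < s) {t : ℕ × ℕ → ℝ} (ht : ∀ p, 0 < t p) (a b : ℕ)
    (p : ℕ × ℕ) : 0 < grow s a b t p := by
  by_cases hp : p = (a, b)
  · subst hp
    simp only [grow, Function.update_self]
    exact mul_pos (numer_pos hs ht a b) (ht _)
  · rw [grow_apply_of_ne _ _ _ _ hp]; exact ht p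

lemma sweep_pos {s : ℝ} (hs : 0 < s) (a b : ℕ) {t : ℕ × ℕ → ℝ} (ht : ∀ p, 0 < t p)
    (p : ℕ × ℕ) : 0 < sweep s a b t p := by
  induction a generalizing b t with
  | zero => exact ht p
  | succ a ih =>
    rcases b with _ | b
    · exact ht p
    · exact ih b (toggle_pos hs ht a b)

lemma sweep_apply_of_not (s : ℝ) (a b : ℕ) (t : ℕ × ℕ → ℝ) (p : ℕ × ℕ)
    (hp : a ≤ p.1 ∨ p.1 + b ≠ p.2 + a) : sweep s a b t p = t p := by
  induction a generalizing b t with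
  | zero => rfl
  | succ a ih =>
    rcases b with _ | b
    · rfl
    · simp only [sweep]
      rw [ih b _ (by omega), toggle_apply_of_ne]
      rintro rfl
      simp at hp
      omega

lemma energy_toggle {s : ℝ} (hs : 0 < s) {S : Finset (ℕ × ℕ)} {t : ℕ × ℕ → ℝ}
    (ht : ∀ p, 0 < t p) {a b : ℕ} (h0 : (a, b) ∈ S) (h1 : (a + 1, b) ∈ S)
    (h2 : (a, b + 1) ∈ S) : energy s S (toggle s a b t) = energy s S t := by
  rw [← sub_eq_zero, energy, energy, ← Finset.sum_sub_distrib]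
  rw [← Finset.sum_subset (s₁ := {(a, b), (a + 1, b), (a, b + 1)})]
  · rw [Finset.sum_insert (by simp), Finset.sum_insert (by simp), Finset.sum_singleton]
    have hN := numer_pos hs ht a b
    have e0 : numer s (toggle s a b t) a b = numer s t a b :=
      numer_congr s a b fun p hp => toggle_apply_of_ne _ _ _ _ (by rintro rfl; simp at hp)
    have e1 : numer s (toggle s a b t) (a + 1) b - numer s t (a + 1) b
        = toggle s a b t (a, b) - t (a, b) := by
      rcases b with _ | b
      · simp [numer]
      · simp only [numer]
        rw [toggle_apply_of_ne s a (b + 1) t (p := (a + 1, b)) (by simp)]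
        ring
    have e2 : numer s (toggle s a b t) a (b + 1) - numer s t a (b + 1)
        = toggle s a b t (a, b) - t (a, b) := by
      rcases a with _ | a
      · simp [numer]
      · simp only [numer]
        rw [toggle_apply_of_ne s (a + 1) b t (p := (a, b + 1)) (by simp)]
        ring
    dsimp only
    rw [e0, toggle_apply_of_ne s a b t (p := (a + 1, b)) (by simp),
      toggle_apply_of_ne s a b t (p := (a, b + 1)) (by simp), ← sub_div, ← sub_div, e1, e2]
    simp only [toggle, Function.update_self]
    have := ht (a, b)
    have := ht (a + 1, b)
    have := ht (a, b + 1)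
    field_simp
    ring
  · intro p hp
    simp only [Finset.mem_insert, Finset.mem_singleton] at hp
    rcases hp with rfl | rfl | rfl <;> assumption
  · rintro ⟨c, d⟩ _ hp
    simp only [Finset.mem_insert, Finset.mem_singleton, Prod.mk.injEq] at hp
    rw [toggle_apply_of_ne _ _ _ _ (by simp; omega), sub_eq_zero]
    congr 1
    refine numer_congr s _ _ fun q hq => toggle_apply_of_ne _ _ _ _ ?_
    rintro rfl
    simp at hq
    omega

lemma energy_sweep {s : ℝ} (hs : 0 < s) {S : Finset (ℕ × ℕ)} (hS : IsLowerSet (S : Set (ℕ × ℕ)))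
    {a b : ℕ} {t : ℕ × ℕ → ℝ} (ht : ∀ p, 0 < t p) (hab : (a, b) ∈ S) :
    energy s S (sweep s a b t) = energy s S t := by
  induction a generalizing b t with
  | zero => rfl
  | succ a ih =>
    rcases b with _ | b
    · rfl
    · have key : ∀ p : ℕ × ℕ, p ≤ (a + 1, b + 1) → p ∈ S := fun p hp => hS hp hab
      simp only [sweep]
      rw [ih (toggle_pos hs ht a b) (key _ (by simp)),
        energy_toggle hs ht (key _ (by simp)) (key _ (by simp)) (key _ (by simp))]

lemma energy_grow {s : ℝ} (hs : 0 < s) {S : Finset (ℕ × ℕ)} {t : ℕ × ℕ → ℝ}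
    (ht : ∀ p, 0 < t p) {a b : ℕ} (h0 : (a, b) ∈ S) (h1 : (a + 1, b) ∉ S)
    (h2 : (a, b + 1) ∉ S) :
    energy s S (grow s a b t) = energy s (S.erase (a, b)) t + 1 / t (a, b) := by
  rw [energy, energy, ← Finset.sum_erase_add _ _ h0]
  congr 1
  · refine Finset.sum_congr rfl fun p hp => ?_
    have hp' := Finset.ne_of_mem_erase hp
    rw [grow_apply_of_ne _ _ _ _ hp']
    congr 1
    refine numer_congr s _ _ fun q hq => grow_apply_of_ne _ _ _ _ ?_
    rintro rfl
    rcases p with ⟨c, d⟩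
    have := Finset.mem_of_mem_erase hp
    rcases hq with ⟨rfl, rfl⟩ | ⟨rfl, rfl⟩ <;> contradiction
  · have e0 : numer s (grow s a b t) a b = numer s t a b :=
      numer_congr s a b fun p hp => grow_apply_of_ne _ _ _ _ (by rintro rfl; simp at hp)
    dsimp only
    rw [e0]
    simp only [grow, Function.update_self]
    have := numer_pos hs ht a b
    have := ht (a, b)
    field_simp

lemma diagProd_sweep {s : ℝ} (hs : 0 < s) (a b : ℕ) {t : ℕ × ℕ → ℝ} (ht : ∀ p, 0 < t p) :
    diagProd (sweep s a b t) a b * diagProd t a b * numer s t a b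
      = (if a = b then s else 1) * (diagProd t a (b + 1) * diagProd t (a + 1) b) := by
  induction a generalizing b t with
  | zero => rcases b with _ | b <;> simp [diagProd, numer]
  | succ a ih =>
    rcases b with _ | b
    · simp [diagProd, numer, diagProd_zero_right]
    · have ih' := ih b (toggle_pos hs ht a b)
      have e0 : numer s (toggle s a b t) a b = numer s t a b :=
        numer_congr s a b fun p hp => toggle_apply_of_ne _ _ _ _ (by rintro rfl; simp at hp)
      have e1 : diagProd (toggle s a b t) a b = diagProd t a b :=
        diagProd_congr a b fun p hp _ => toggle_apply_of_ne _ _ _ _ (by rintro rfl; simp at hp)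
      have e2 : diagProd (toggle s a b t) a (b + 1) = diagProd t a (b + 1) :=
        diagProd_congr _ _ fun p hp _ => toggle_apply_of_ne _ _ _ _ (by rintro rfl; simp at hp)
      have e3 : diagProd (toggle s a b t) (a + 1) b = diagProd t (a + 1) b :=
        diagProd_congr _ _ fun p hp hp' =>
          toggle_apply_of_ne _ _ _ _ (by rintro rfl; simp at hp'; omega)
      rw [e0, e1, e2, e3] at ih'
      have hval : toggle s a b t (a, b) =
          numer s t a b / ((1 / t (a + 1, b) + 1 / t (a, b + 1)) * t (a, b)) := by
        simp [toggle]
      have hsweep : sweep s (a + 1) (b + 1) t = sweep s a b (toggle s a b t) := rfl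
      have hnum : numer s t (a + 1) (b + 1) = t (a, b + 1) + t (a + 1, b) := rfl
      have hd : ∀ t' : ℕ × ℕ → ℝ, ∀ c d, diagProd t' (c + 1) (d + 1) = t' (c, d) * diagProd t' c d :=
        fun _ _ _ => rfl
      simp only [hsweep, hnum, hd, sweep_apply_of_not s a b _ (a, b) (by simp), hval,
        add_left_inj]
      generalize diagProd (sweep s a b (toggle s a b t)) a b = X at ih' ⊢
      have h0 := ht (a, b)
      have h1 := ht (a + 1, b)
      have h2 := ht (a, b + 1)
      have hN := numer_pos hs ht a b
      generalize numer s t a b = N at *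
      field_simp
      linear_combination ih'

end algebra

section rsk

/-- The product of the entries of `w` on an `a × b` rectangle, each diagonal entry weighted
by `s`. -/
noncomputable def rectProd (s : ℝ) (w : ℕ × ℕ → ℝ) (a b : ℕ) : ℝ :=
  ∏ i ∈ Finset.range a, ∏ j ∈ Finset.range b, ((if i = j then s else 1) * w (i, j))

lemma rectProd_pos {s : ℝ} (hs : 0 < s) {w : ℕ × ℕ → ℝ} (hw : ∀ p, 0 < w p) (a b : ℕ) :
    0 < rectProd s w a b := by
  refine Finset.prod_pos fun i _ => Finset.prod_pos fun j _ => mul_pos ?_ (hw _)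
  split_ifs <;> simp [hs]

lemma rectProd_zero_left (s : ℝ) (w : ℕ × ℕ → ℝ) (b : ℕ) : rectProd s w 0 b = 1 := by
  simp [rectProd]

lemma rectProd_zero_right (s : ℝ) (w : ℕ × ℕ → ℝ) (a : ℕ) : rectProd s w a 0 = 1 := by
  simp [rectProd]

lemma rectProd_succ_left (s : ℝ) (w : ℕ × ℕ → ℝ) (a b : ℕ) :
    rectProd s w (a + 1) b
      = rectProd s w a b * ∏ j ∈ Finset.range b, ((if a = j then s else 1) * w (a, j)) := by
  simp [rectProd, Finset.prod_range_succ]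

lemma rectProd_mul_rectProd (s : ℝ) (w : ℕ × ℕ → ℝ) (a b : ℕ) :
    rectProd s w (a + 1) (b + 1) * rectProd s w a b
      = rectProd s w a (b + 1) * rectProd s w (a + 1) b * ((if a = b then s else 1) * w (a, b)) := by
  rw [rectProd_succ_left s w a (b + 1), rectProd_succ_left s w a b, Finset.prod_range_succ]
  ring

/-- The array with logarithmic coordinates `u` on the `n × n` square, extended by `1`. -/
noncomputable def expExt (n : ℕ) (u : Fin n × Fin n → ℝ) : ℕ × ℕ → ℝ := fun p =>
  if h : p.1 < n ∧ p.2 < n then Real.exp (u (⟨p.1, h.1⟩, ⟨p.2, h.2⟩)) else 1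

lemma expExt_pos (n : ℕ) (u : Fin n × Fin n → ℝ) (p : ℕ × ℕ) : 0 < expExt n u p := by
  unfold expExt
  split_ifs
  · exact Real.exp_pos _
  · exact one_pos

lemma expExt_apply (n : ℕ) (u : Fin n × Fin n → ℝ) (i j : Fin n) :
    expExt n u (i, j) = Real.exp (u (i, j)) := by
  simp [expExt]

lemma expExt_update (n : ℕ) (u : Fin n × Fin n → ℝ) (i j : Fin n) (x : ℝ) :
    expExt n (Function.update u (i, j) x)
      = Function.update (expExt n u) ((i : ℕ), (j : ℕ)) (Real.exp x) := by
  ext ⟨a, b⟩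
  by_cases h : a < n ∧ b < n
  · obtain ⟨a, rfl⟩ : ∃ a' : Fin n, (a' : ℕ) = a := ⟨⟨a, h.1⟩, rfl⟩
    obtain ⟨b, rfl⟩ : ∃ b' : Fin n, (b' : ℕ) = b := ⟨⟨b, h.2⟩, rfl⟩
    rw [expExt_apply]
    by_cases hab : (a, b) = (i, j)
    · obtain ⟨rfl, rfl⟩ := Prod.mk.inj hab
      simp
    · rw [Function.update_of_ne hab, Function.update_of_ne, expExt_apply]
      simpa [Fin.ext_iff] using hab
  · have : (a, b) ≠ ((i : ℕ), (j : ℕ)) := by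
      rintro h'
      obtain ⟨rfl, rfl⟩ := Prod.mk.inj h'
      exact h ⟨i.2, j.2⟩
    rw [Function.update_of_ne this]
    simp [expExt, h]

lemma measurable_expExt (n : ℕ) (p : ℕ × ℕ) : Measurable fun u => expExt n u p := by
  unfold expExt
  split_ifs
  · fun_prop
  · fun_prop

lemma measurable_numer_expExt (n : ℕ) (s : ℝ) (a b : ℕ) :
    Measurable fun u => numer s (expExt n u) a b := by
  have := measurable_expExt n
  rcases a with _ | a <;> rcases b with _ | b <;> simp only [numer] <;> fun_prop

lemma measurePreserving_affine (c ε : ℝ) (hε : ε = 1 ∨ ε = -1) :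
    MeasurePreserving (fun x : ℝ => c + ε * x) := by
  rcases hε with rfl | rfl
  · simpa using measurePreserving_add_left volume c
  · simpa [Function.comp_def] using (measurePreserving_add_left volume c).comp (Measure.measurePreserving_neg volume)

lemma measurePreserving_update {ι : Type*} [Fintype ι] [DecidableEq ι] (i : ι) (ε : ℝ)
    (hε : ε = 1 ∨ ε = -1) (c : (ι → ℝ) → ℝ) (hc : Measurable c)
    (hdep : ∀ u x, c (Function.update u i x) = c u) :
    MeasurePreserving (fun u : ι → ℝ => Function.update u i (c u + ε * u i)) := by
  let e := MeasurableEquiv.piEquivPiSubtypeProd (fun _ : ι => ℝ) (fun j => j ≠ i)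
  have he : MeasurePreserving e := volume_preserving_piEquivPiSubtypeProd (fun _ => ℝ) _
  let g : ({j // j ≠ i} → ℝ) → ({j // ¬ j ≠ i} → ℝ) → ({j // ¬ j ≠ i} → ℝ) :=
    fun a x k => c (e.symm (a, 0)) + ε * x k
  have hg : Measurable (Function.uncurry g) := by
    refine measurable_pi_lambda _ fun k => ?_
    have h1 : Measurable fun p : ({j // j ≠ i} → ℝ) × ({j // ¬ j ≠ i} → ℝ) =>
        c (e.symm (p.1, 0)) := hc.comp (e.symm.measurable.comp (by fun_prop))
    have h2 : Measurable fun p : ({j // j ≠ i} → ℝ) × ({j // ¬ j ≠ i} → ℝ) => ε * p.2 k := by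
      fun_prop
    exact h1.add h2
  have hskew := (MeasurePreserving.id (volume : Measure ({j // j ≠ i} → ℝ))).skew_product
    (μc := (volume : Measure ({j // ¬ j ≠ i} → ℝ))) (μd := volume) hg
    (Filter.Eventually.of_forall fun a =>
      (volume_preserving_pi fun _ => measurePreserving_affine (c (e.symm (a, 0))) ε hε).map_eq)
  have := he.symm.comp (hskew.comp he)
  convert this using 1
  ext u j
  have hcu : c (e.symm ((e u).1, 0)) = c u := by
    rw [← hdep u 0]
    congr 1
    ext k
    by_cases hk : k = i
    · subst hk
      simp [e, MeasurableEquiv.piEquivPiSubtypeProd, Equiv.piEquivPiSubtypeProd]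
    · simp [e, MeasurableEquiv.piEquivPiSubtypeProd, Equiv.piEquivPiSubtypeProd, hk]
  by_cases hj : j = i
  · subst hj
    simp only [Function.update_self, Function.comp, id]
    simp [e, g, MeasurableEquiv.piEquivPiSubtypeProd, Equiv.piEquivPiSubtypeProd] at hcu ⊢
    exact hcu.symm
  · simp [e, g, MeasurableEquiv.piEquivPiSubtypeProd, Equiv.piEquivPiSubtypeProd, hj]

/-- In logarithmic coordinates on the cells of an `n × n` square, `f` preserves Lebesgue
measure. -/
def LogVolumePreserving (n : ℕ) (f : (ℕ × ℕ → ℝ) → ℕ × ℕ → ℝ) : Prop :=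
  ∃ Φ : (Fin n × Fin n → ℝ) → Fin n × Fin n → ℝ,
    MeasurePreserving Φ ∧ ∀ u, expExt n (Φ u) = f (expExt n u)

lemma LogVolumePreserving.comp {n : ℕ} {f g : (ℕ × ℕ → ℝ) → ℕ × ℕ → ℝ}
    (hf : LogVolumePreserving n f) (hg : LogVolumePreserving n g) :
    LogVolumePreserving n (fun t => f (g t)) := by
  obtain ⟨Φ, h1, h2⟩ := hf
  obtain ⟨Ψ, h3, h4⟩ := hg
  exact ⟨Φ ∘ Ψ, h1.comp h3, fun u => by simp [h2, h4]⟩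

lemma logVolumePreserving_id (n : ℕ) : LogVolumePreserving n (fun t => t) :=
  ⟨id, MeasurePreserving.id _, fun _ => rfl⟩

lemma logVolumePreserving_grow {n : ℕ} {s : ℝ} (hs : 0 < s) {a b : ℕ} (ha : a < n) (hb : b < n) :
    LogVolumePreserving n (grow s a b) := by
  refine ⟨_, measurePreserving_update ((⟨a, ha⟩, ⟨b, hb⟩) : Fin n × Fin n) 1 (Or.inl rfl)
    (fun u => Real.log (numer s (expExt n u) a b)) (measurable_numer_expExt n s a b).log
    (fun u x => ?_), fun u => ?_⟩
  · rw [expExt_update]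
    congr 1
    exact numer_congr s a b fun p hp => Function.update_of_ne (by rintro rfl; simp at hp) _ _
  · rw [expExt_update, Real.exp_add, Real.exp_log (numer_pos hs (expExt_pos n u) a b), one_mul,
      ← expExt_apply]
    rfl

lemma logVolumePreserving_toggle {n : ℕ} {s : ℝ} (hs : 0 < s) {a b : ℕ} (ha : a < n)
    (hb : b < n) : LogVolumePreserving n (toggle s a b) := by
  refine ⟨_, measurePreserving_update ((⟨a, ha⟩, ⟨b, hb⟩) : Fin n × Fin n) (-1) (Or.inr rfl)
    (fun u => Real.log (numer s (expExt n u) a b /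
      (1 / expExt n u (a + 1, b) + 1 / expExt n u (a, b + 1)))) ?_
    (fun u x => ?_), fun u => ?_⟩
  · have := measurable_expExt n
    have := measurable_numer_expExt n s a b
    fun_prop
  · rw [expExt_update, Function.update_of_ne (by simp), Function.update_of_ne (by simp)]
    congr 2
    exact numer_congr s a b fun p hp => Function.update_of_ne (by rintro rfl; simp at hp) _ _
  · have h1 := expExt_pos n u (a + 1, b)
    have h2 := expExt_pos n u (a, b + 1)
    have h3 := numer_pos hs (expExt_pos n u) a b
    rw [expExt_update, Real.exp_add, Real.exp_log (by positivity), neg_one_mul, Real.exp_neg,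
      ← expExt_apply, toggle, ← div_eq_mul_inv, div_div]

lemma logVolumePreserving_sweep {n : ℕ} {s : ℝ} (hs : 0 < s) {a b : ℕ} (ha : a < n)
    (hb : b < n) : LogVolumePreserving n (sweep s a b) := by
  induction a generalizing b with
  | zero => exact logVolumePreserving_id n
  | succ a ih =>
    rcases b with _ | b
    · exact logVolumePreserving_id n
    · exact (ih (by omega) (by omega)).comp
        (logVolumePreserving_toggle hs (by omega) (by omega))

/-- A growth form of the geometric Robinson–Schensted–Knuth correspondence. -/
theorem exists_geometricRSK (n : ℕ) {s : ℝ} (hs : 0 < s) (S : Finset (ℕ × ℕ))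
    (hS : IsLowerSet (S : Set (ℕ × ℕ))) (hSn : ∀ p ∈ S, p.1 < n ∧ p.2 < n) :
    ∃ f, LogVolumePreserving n f ∧ ∀ w : ℕ × ℕ → ℝ, (∀ p, 0 < w p) →
      (∀ p, 0 < f w p) ∧ (∀ p ∉ S, f w p = w p) ∧
      energy s S (f w) = ∑ p ∈ S, 1 / w p ∧
      ∀ a b, (a, b) ∈ S → (a + 1, b + 1) ∉ S →
        diagProd (f w) (a + 1) (b + 1) = rectProd s w (a + 1) (b + 1) := by
  induction hm : S.card generalizing S with
  | zero =>
    obtain rfl := Finset.card_eq_zero.mp hm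
    exact ⟨fun t => t, logVolumePreserving_id n, fun w hw => ⟨hw, by simp, by simp [energy],
      by simp⟩⟩
  | succ m ih =>
    obtain ⟨⟨i, j⟩, hmax⟩ := S.exists_maximal (Finset.card_pos.mp (by omega))
    have hij : (i, j) ∈ S := hmax.prop
    have hmax' : ∀ q, (i, j) ≤ q → q ≠ (i, j) → q ∉ S := fun q h1 h2 h3 =>
      h2 (hmax.eq_of_ge h3 h1)
    have hS0 : IsLowerSet ((S.erase (i, j) : Finset _) : Set (ℕ × ℕ)) := by
      intro p q hqp hp
      simp only [Finset.coe_erase, Set.mem_sdiff, Finset.mem_coe, Set.mem_singleton_iff] at hp ⊢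
      refine ⟨hS hqp hp.1, ?_⟩
      rintro rfl
      exact hmax' p hqp hp.2 hp.1
    obtain ⟨f, hf, hfw⟩ := ih (S.erase (i, j)) hS0 (fun p hp => hSn p (Finset.mem_of_mem_erase hp))
      (by rw [Finset.card_erase_of_mem hij]; omega)
    obtain ⟨hi, hj⟩ := hSn _ hij
    refine ⟨fun t => sweep s i j (grow s i j (f t)),
      (logVolumePreserving_sweep hs hi hj).comp ((logVolumePreserving_grow hs hi hj).comp hf),
      fun w hw => ?_⟩
    obtain ⟨hpos, hout, hen, hdiag⟩ := hfw w hw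
    have hgpos := grow_pos hs hpos i j
    have hw0 : f w (i, j) = w (i, j) := hout _ (by simp)
    refine ⟨sweep_pos hs i j hgpos, fun p hp => ?_, ?_, fun a b hab hab' => ?_⟩ <;> beta_reduce
    · have hne : p ≠ (i, j) := by rintro rfl; exact hp hij
      have hle : i ≤ p.1 ∨ p.1 + j ≠ p.2 + i := by
        by_contra! h
        exact hp (hS (show p ≤ (i, j) from ⟨h.1.le, by simp only; omega⟩) hij)
      rw [sweep_apply_of_not _ _ _ _ _ hle, grow_apply_of_ne _ _ _ _ hne]
      exact hout p (by simp [hp])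
    · rw [energy_sweep hs hS hgpos hij, energy_grow hs hpos hij (hmax' _ (by simp) (by simp))
        (hmax' _ (by simp) (by simp)), hen, hw0, Finset.sum_erase_add _ _ hij]
    · by_cases hne : (a, b) = (i, j)
      · obtain ⟨rfl, rfl⟩ := Prod.mk.inj hne
        have hT : ∀ c d, c = a ∧ d = b ∨ c = a ∧ d = b + 1 ∨ c = a + 1 ∧ d = b →
            diagProd (f w) c d = rectProd s w c d := by
          intro c d hcd
          rcases c with _ | c
          · rw [rectProd_zero_left]; rfl
          rcases d with _ | d
          · rw [rectProd_zero_right]; rfl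
          refine hdiag c d ?_ ?_
          · simp only [Finset.mem_erase, ne_eq, Prod.mk.injEq]
            exact ⟨by omega, hS (show (c, d) ≤ (a, b) from ⟨by simp only; omega, by simp only; omega⟩) hij⟩
          · intro hmem
            rw [Finset.mem_erase] at hmem
            have : c + 1 ≤ a ∧ d + 1 ≤ b ∨ a ≤ c + 1 ∧ b ≤ d + 1 := by omega
            rcases this with h | h
            · exact hmem.1 (by ext <;> simp only <;> omega)
            · exact hmax' _ ⟨h.1, h.2⟩ hmem.1 hmem.2
        have key := diagProd_sweep hs a b hgpos
        have e0 : numer s (grow s a b (f w)) a b = numer s (f w) a b :=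
          numer_congr s a b fun p hp => grow_apply_of_ne _ _ _ _ (by rintro rfl; simp at hp)
        have e1 : diagProd (grow s a b (f w)) a b = diagProd (f w) a b :=
          diagProd_congr a b fun p hp _ => grow_apply_of_ne _ _ _ _ (by rintro rfl; simp at hp)
        have e2 : diagProd (grow s a b (f w)) a (b + 1) = diagProd (f w) a (b + 1) :=
          diagProd_congr _ _ fun p hp _ => grow_apply_of_ne _ _ _ _ (by rintro rfl; simp at hp)
        have e3 : diagProd (grow s a b (f w)) (a + 1) b = diagProd (f w) (a + 1) b :=
          diagProd_congr _ _ fun p hp hp' =>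
            grow_apply_of_ne _ _ _ _ (by rintro rfl; simp at hp'; omega)
        rw [e0, e1, e2, e3, hT a b (by omega),
          hT a (b + 1) (by omega),
          hT (a + 1) b (by omega)] at key
        have hd : ∀ t' : ℕ × ℕ → ℝ, diagProd t' (a + 1) (b + 1) = t' (a, b) * diagProd t' a b :=
          fun _ => rfl
        have hval : grow s a b (f w) (a, b) = numer s (f w) a b * w (a, b) := by
          simp [grow, hw0]
        rw [hd, sweep_apply_of_not s a b _ (a, b) (by simp), hval]
        have hR := rectProd_pos hs hw a b
        have hRR := rectProd_mul_rectProd s w a b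
        apply mul_right_cancel₀ hR.ne'
        rw [hRR]
        linear_combination w (a, b) * key
      · have hd : a + j ≠ b + i := by
          intro h
          rcases lt_or_ge a i with h1 | h1
          · exact hab' (hS (show (a + 1, b + 1) ≤ (i, j) from
              ⟨by simp only; omega, by simp only; omega⟩) hij)
          · exact hmax' (a, b) ⟨h1, by simp only; omega⟩ hne hab
        rw [← hdiag a b (by simp only [Finset.mem_erase]; exact ⟨hne, hab⟩)
          (fun h => hab' (Finset.mem_of_mem_erase h))]
        refine diagProd_congr _ _ fun p _ hp => ?_
        rw [sweep_apply_of_not _ _ _ _ _ (by omega), grow_apply_of_ne _ _ _ _ ?_]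
        rintro rfl
        simp only at hp
        omega

end rsk

section pattern

lemma sum_numer_column (s : ℝ) (t : ℕ × ℕ → ℝ) (m k : ℕ) :
    ∑ a ∈ Finset.range (k + 1), numer s t a (m + 1) / t (a, m + 1) + t (k, m + 1) / t (k + 1, m + 1)
      = ∑ a ∈ Finset.range (k + 1),
          (t (a, m) / t (a, m + 1) + t (a, m + 1) / t (a + 1, m + 1)) := by
  induction k with
  | zero => simp [numer]
  | succ k ih =>
    rw [Finset.sum_range_succ _ (k + 1), Finset.sum_range_succ _ (k + 1), ← ih]
    simp only [numer]
    ring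

lemma numer_swap (s : ℝ) (t : ℕ × ℕ → ℝ) (a b : ℕ) :
    numer s (fun p => t p.swap) a b = numer s t b a := by
  rcases a with _ | a <;> rcases b with _ | b <;> simp [numer, add_comm]

lemma diagProd_swap (t : ℕ × ℕ → ℝ) (a b : ℕ) :
    diagProd (fun p => t p.swap) a b = diagProd t b a := by
  induction a generalizing b with
  | zero => rw [diagProd_zero_right]; rfl
  | succ a ih =>
    rcases b with _ | b
    · rfl
    · simp [diagProd, ih]

lemma rectProd_swap (s : ℝ) (w : ℕ × ℕ → ℝ) (a b : ℕ) :
    rectProd s (fun p => w p.swap) a b = rectProd s w b a := by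
  rw [rectProd, rectProd, Finset.prod_comm]
  simp [eq_comm]

noncomputable def triangleSum (t : ℕ × ℕ → ℝ) (n : ℕ) : ℝ :=
  ∑ b ∈ Finset.range n, ∑ a ∈ Finset.range b, (t (a, b - 1) / t (a, b) + t (a, b) / t (a + 1, b))

lemma energy_square (s : ℝ) (t : ℕ × ℕ → ℝ) (n : ℕ) :
    energy s (Finset.range (n + 1) ×ˢ Finset.range (n + 1)) t
      = s / t (0, 0) + triangleSum t (n + 1) + triangleSum (fun p => t p.swap) (n + 1) := by
  rw [energy, Finset.sum_product]
  induction n with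
  | zero => simp [triangleSum, numer]
  | succ n ih =>
    rw [Finset.sum_range_succ]
    simp_rw [Finset.sum_range_succ _ (n + 1)]
    rw [Finset.sum_add_distrib, ih, triangleSum, triangleSum, triangleSum, triangleSum,
      Finset.sum_range_succ _ (n + 1), Finset.sum_range_succ _ (n + 1)]
    have h1 := sum_numer_column s t n n
    have h2 := sum_numer_column s (fun p => t p.swap) n n
    simp_rw [numer_swap] at h2
    simp only [Prod.swap] at h2
    have h3 : numer s t (n + 1) (n + 1) = t (n, n + 1) + t (n + 1, n) := rfl
    simp only [Nat.add_sub_cancel, Prod.swap]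
    rw [← h1, ← h2, h3]
    ring

lemma sum_antidiagonal_eq (g : ℕ → ℕ → ℝ) (n : ℕ) :
    ∑ k ∈ Finset.range (n - 1), ∑ j ∈ Finset.range (k + 1), g (k - j) (n - 1 - j)
      = ∑ b ∈ Finset.range n, ∑ a ∈ Finset.range b, g a b := by
  rw [Finset.sum_sigma', Finset.sum_sigma']
  refine Finset.sum_bij' (fun p _ => ⟨n - 1 - p.2, p.1 - p.2⟩)
    (fun p _ => ⟨p.2 + (n - 1 - p.1), n - 1 - p.1⟩) ?_ ?_ ?_ ?_ ?_
  · rintro ⟨k, j⟩ h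
    simp only [Finset.mem_sigma, Finset.mem_range] at h ⊢
    omega
  · rintro ⟨k, j⟩ h
    simp only [Finset.mem_sigma, Finset.mem_range] at h ⊢
    omega
  · rintro ⟨k, j⟩ h
    simp only [Finset.mem_sigma, Finset.mem_range] at h
    simp only [Sigma.mk.injEq, heq_eq_eq]
    omega
  · rintro ⟨k, j⟩ h
    simp only [Finset.mem_sigma, Finset.mem_range] at h
    simp only [Sigma.mk.injEq, heq_eq_eq]
    omega
  · rintro ⟨k, j⟩ _
    rfl

lemma diagProd_eq_prod (t : ℕ × ℕ → ℝ) (a b : ℕ) (hab : a ≤ b) :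
    diagProd t a b = ∏ j ∈ Finset.range a, t (a - 1 - j, b - 1 - j) := by
  induction a generalizing b with
  | zero => rfl
  | succ a ih =>
    obtain ⟨b, rfl⟩ : ∃ c, b = c + 1 := ⟨b - 1, by omega⟩
    rw [Finset.prod_range_succ', diagProd, ih b (by omega), mul_comm]
    congr 1
    exact Finset.prod_congr rfl fun j _ => by congr 2 <;> omega

variable {n : ℕ} {x : Fin n → ℝ} {z : GTArray n} {t : ℕ × ℕ → ℝ}

lemma Ffun_eq_triangleSum (h : ∀ k j, j ≤ k → k < n → Zent n x z k j = t (k - j, n - 1 - j)) :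
    Ffun n x z = triangleSum t n := by
  rw [triangleSum, ← sum_antidiagonal_eq
    (fun a b => t (a, b - 1) / t (a, b) + t (a, b) / t (a + 1, b)), Ffun]
  refine Finset.sum_congr rfl fun k hk => Finset.sum_congr rfl fun j hj => ?_
  rw [Finset.mem_range] at hk hj
  rw [h _ _ (by omega) (by omega), h _ _ (by omega) (by omega), h _ _ (by omega) (by omega)]
  rw [show k + 1 - (j + 1) = k - j by omega, show n - 1 - (j + 1) = n - 1 - j - 1 by omega,
    show k + 1 - j = k - j + 1 by omega]

lemma wfun_eq_prod (h : ∀ k j, j ≤ k → k < n → Zent n x z k j = t (k - j, n - 1 - j))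
    (lam : Fin n → ℂ) :
    wfun n lam x z = ∏ k : Fin n,
      Complex.exp (-lam k * (Real.log (diagProd t (k + 1) n / diagProd t k n) : ℂ)) := by
  rw [wfun, Finset.prod_range]
  refine Finset.prod_congr rfl fun k _ => ?_
  have h1 : ∏ j ∈ Finset.range (k + 1), Zent n x z k j = diagProd t (k + 1) n := by
    rw [diagProd_eq_prod _ _ _ k.2]
    refine Finset.prod_congr rfl fun j hj => ?_
    rw [Finset.mem_range] at hj
    exact h _ _ (by omega) k.2
  have h2 : ∏ j ∈ Finset.range k, Zent n x z (k - 1) j = diagProd t k n := by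
    rw [diagProd_eq_prod _ _ _ k.2.le]
    refine Finset.prod_congr rfl fun j hj => ?_
    rw [Finset.mem_range] at hj
    exact h _ _ (by omega) (by omega)
  rw [h1, h2, dif_pos k.2]

/-- The integrand of the Cauchy identity on `n × n` matrices, the bottom row being the main
diagonal and the two triangular arrays the two triangles. -/
noncomputable def matrixIntegrand (n : ℕ) (s : ℝ) (lam nu : Fin n → ℂ) (t : ℕ × ℕ → ℝ) : ℂ :=
  Real.exp (-energy s (Finset.range n ×ˢ Finset.range n) t) *
    (∏ k : Fin n, Complex.exp (-lam k * (Real.log (diagProd t (k + 1) n / diagProd t k n) : ℂ))) *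
    ∏ k : Fin n, Complex.exp (-nu k * (Real.log (diagProd t n (k + 1) / diagProd t n k) : ℂ))

noncomputable def cellWeight (δ : ℝ) (μ : ℂ) (v : ℝ) : ℂ :=
  Complex.exp (-μ * ((v + δ : ℝ) : ℂ)) * Real.exp (-Real.exp (-v))

lemma log_rectProd_ratio {s : ℝ} (hs : 0 < s) {w : ℕ × ℕ → ℝ} (hw : ∀ p, 0 < w p) (k m : ℕ) :
    Real.log (rectProd s w (k + 1) m / rectProd s w k m)
      = ∑ j ∈ Finset.range m, (Real.log (w (k, j)) + if k = j then Real.log s else 0) := by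
  rw [rectProd_succ_left, mul_div_cancel_left₀ _ (rectProd_pos hs hw k m).ne', Real.log_prod]
  · refine Finset.sum_congr rfl fun j _ => ?_
    split_ifs
    · rw [Real.log_mul hs.ne' (hw _).ne', add_comm]
    · simp
  · intro j _
    have := hw (k, j)
    split_ifs <;> positivity

lemma matrixIntegrand_rsk {s : ℝ} (hs : 0 < s) (lam nu : Fin n → ℂ) {t : ℕ × ℕ → ℝ}
    {u : Fin n × Fin n → ℝ}
    (hen : energy s (Finset.range n ×ˢ Finset.range n) t
      = ∑ p ∈ Finset.range n ×ˢ Finset.range n, 1 / expExt n u p)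
    (hrow : ∀ k ≤ n, diagProd t k n = rectProd s (expExt n u) k n)
    (hcol : ∀ k ≤ n, diagProd t n k = rectProd s (expExt n u) n k) :
    matrixIntegrand n s lam nu t
      = ∏ p : Fin n × Fin n,
          cellWeight (if p.1 = p.2 then Real.log s else 0) (lam p.1 + nu p.2) (u p) := by
  have hw := expExt_pos n u
  have h1 : ∏ k : Fin n, Complex.exp (-lam k *
      (Real.log (diagProd t (k + 1) n / diagProd t k n) : ℂ)) = ∏ k : Fin n, ∏ j : Fin n,
      Complex.exp (-lam k * ((u (k, j) + if k = j then Real.log s else 0 : ℝ) : ℂ)) := by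
    refine Finset.prod_congr rfl fun k _ => ?_
    rw [hrow _ k.2, hrow _ k.2.le, log_rectProd_ratio hs hw, ← Complex.exp_sum, ← Finset.mul_sum,
      Finset.sum_range, Complex.ofReal_sum]
    simp_rw [expExt_apply, Real.log_exp, Fin.ext_iff]
  have h2 : ∏ k : Fin n, Complex.exp (-nu k *
      (Real.log (diagProd t n (k + 1) / diagProd t n k) : ℂ)) = ∏ k : Fin n, ∏ j : Fin n,
      Complex.exp (-nu k * ((u (j, k) + if j = k then Real.log s else 0 : ℝ) : ℂ)) := by
    refine Finset.prod_congr rfl fun k _ => ?_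
    rw [hcol _ k.2, hcol _ k.2.le, ← rectProd_swap s _ _ n, ← rectProd_swap s _ _ n,
      log_rectProd_ratio hs fun p => hw p.swap, ← Complex.exp_sum, ← Finset.mul_sum,
      Finset.sum_range, Complex.ofReal_sum]
    simp_rw [Prod.swap, expExt_apply, Real.log_exp, Fin.ext_iff, eq_comm]
  rw [matrixIntegrand, h1, h2, hen, Finset.sum_product, Finset.sum_range]
  simp_rw [Finset.sum_range, expExt_apply, ← Finset.sum_neg_distrib, Real.exp_sum,
    Complex.ofReal_prod]
  rw [Finset.prod_comm (f := fun k j : Fin n =>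
    Complex.exp (-nu k * ((u (j, k) + if j = k then Real.log s else 0 : ℝ) : ℂ)))]
  rw [Fintype.prod_prod_type]
  simp_rw [← Finset.prod_mul_distrib]
  refine Finset.prod_congr rfl fun i _ => Finset.prod_congr rfl fun j _ => ?_
  rw [cellWeight, mul_assoc, ← Complex.exp_add, mul_comm, ← add_mul, one_div, Real.exp_neg (u (i, j)),
    neg_add]

lemma measurable_diagProd_expExt (n a b : ℕ) : Measurable fun u => diagProd (expExt n u) a b := by
  induction a generalizing b with
  | zero => simp [diagProd]
  | succ a ih =>
    rcases b with _ | b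
    · simp [diagProd]
    · exact (measurable_expExt n _).mul (ih b)

lemma measurable_matrixIntegrand (n : ℕ) (s : ℝ) (lam nu : Fin n → ℂ) :
    Measurable fun u => matrixIntegrand n s lam nu (expExt n u) := by
  have h1 := measurable_expExt n
  have h2 := measurable_numer_expExt n s
  have h3 := measurable_diagProd_expExt n
  unfold matrixIntegrand energy
  fun_prop

end pattern

section gamma

lemma image_exp_neg : (fun v : ℝ => Real.exp (-v)) '' Set.univ = Set.Ioi 0 := by
  ext x
  simp only [Set.image_univ, Set.mem_range, Set.mem_Ioi]
  exact ⟨fun ⟨v, hv⟩ => hv ▸ Real.exp_pos _, fun hx => ⟨-Real.log x, by simp [Real.exp_log hx]⟩⟩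

lemma cellWeight_eq (δ : ℝ) (μ : ℂ) (v : ℝ) :
    cellWeight δ μ v = Complex.exp (-μ * δ) * (|-Real.exp (-v)| •
      ((Real.exp (-Real.exp (-v)) : ℂ) * (Real.exp (-v) : ℂ) ^ (μ - 1))) := by
  rw [cellWeight, abs_neg, abs_of_pos (Real.exp_pos _), Complex.real_smul,
    Complex.cpow_def_of_ne_zero (by exact_mod_cast (Real.exp_pos (-v)).ne'), ← Complex.ofReal_log
      (Real.exp_pos _).le, Real.log_exp]
  have : Complex.exp (-μ * ((v + δ : ℝ) : ℂ)) = Complex.exp (-μ * δ) * ((Real.exp (-v) : ℂ) *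
      Complex.exp (((-v : ℝ) : ℂ) * (μ - 1))) := by
    rw [Complex.ofReal_exp, ← Complex.exp_add, ← Complex.exp_add]
    congr 1
    push_cast
    ring
  rw [this]
  ring

lemma hasDerivWithinAt_exp_neg (v : ℝ) :
    HasDerivWithinAt (fun v : ℝ => Real.exp (-v)) (-Real.exp (-v)) Set.univ v := by
  have h : HasDerivAt (fun v : ℝ => Real.exp (-v)) (-Real.exp (-v)) v := by
    simpa using (hasDerivAt_neg v).exp
  exact h.hasDerivWithinAt

lemma injOn_exp_neg : Set.InjOn (fun v : ℝ => Real.exp (-v)) Set.univ := fun _ _ _ _ h => by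
  simpa using h

lemma integrable_cellWeight (δ : ℝ) {μ : ℂ} (hμ : 0 < μ.re) : Integrable (cellWeight δ μ) := by
  have h := Complex.GammaIntegral_convergent hμ
  rw [← image_exp_neg, integrableOn_image_iff_integrableOn_abs_deriv_smul MeasurableSet.univ
    (fun v _ => hasDerivWithinAt_exp_neg v) injOn_exp_neg, integrableOn_univ] at h
  refine (h.const_mul (Complex.exp (-μ * δ))).congr (Filter.Eventually.of_forall fun v => ?_)
  exact (cellWeight_eq δ μ v).symm

lemma integral_cellWeight (δ : ℝ) {μ : ℂ} (hμ : 0 < μ.re) :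
    ∫ v, cellWeight δ μ v = Complex.exp (-μ * δ) * Complex.Gamma μ := by
  rw [Complex.Gamma_eq_integral hμ, Complex.GammaIntegral, ← image_exp_neg,
    integral_image_eq_integral_abs_deriv_smul MeasurableSet.univ
      (fun v _ => hasDerivWithinAt_exp_neg v) injOn_exp_neg, setIntegral_univ,
    ← integral_const_mul]
  exact integral_congr_ae (Filter.Eventually.of_forall fun v => cellWeight_eq δ μ v)

variable {n : ℕ}

theorem integral_matrixIntegrand {s : ℝ} (hs : 0 < s) (lam nu : Fin n → ℂ)
    (hre : ∀ i j, 0 < (lam i + nu j).re) :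
    Integrable (fun u => matrixIntegrand n s lam nu (expExt n u)) ∧
    ∫ u, matrixIntegrand n s lam nu (expExt n u) =
      Complex.exp ((-(∑ i, (nu i + lam i))) * (Real.log s : ℂ)) *
        ∏ i, ∏ j, Complex.Gamma (nu i + lam j) := by
  obtain ⟨f, ⟨Φ, hΦ, hΦf⟩, hf⟩ := exists_geometricRSK n hs (Finset.range n ×ˢ Finset.range n)
    (by
      rintro ⟨a, b⟩ ⟨c, d⟩ ⟨h1, h2⟩ h
      simp only [Finset.coe_product, Finset.coe_range, Set.mem_prod, Set.mem_Iio] at h h1 h2 ⊢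
      omega)
    (by simp)
  have hcomp : ∀ u, matrixIntegrand n s lam nu (expExt n (Φ u)) = ∏ p : Fin n × Fin n,
      cellWeight (if p.1 = p.2 then Real.log s else 0) (lam p.1 + nu p.2) (u p) := by
    intro u
    obtain ⟨-, -, hen, hdiag⟩ := hf (expExt n u) (expExt_pos n u)
    rw [hΦf]
    refine matrixIntegrand_rsk hs lam nu hen (fun k hk => ?_) (fun k hk => ?_)
    · rcases k with _ | k
      · rw [rectProd_zero_left]; rfl
      · obtain ⟨m, rfl⟩ : ∃ m, n = m + 1 := ⟨n - 1, by omega⟩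
        exact hdiag k m (by simp; omega) (by simp)
    · rcases k with _ | k
      · rw [rectProd_zero_right, diagProd_zero_right]
      · obtain ⟨m, rfl⟩ : ∃ m, n = m + 1 := ⟨n - 1, by omega⟩
        exact hdiag m k (by simp; omega) (by simp)
  have hmeas := (measurable_matrixIntegrand n s lam nu).aestronglyMeasurable
    (μ := (volume : Measure (Fin n × Fin n → ℝ)))
  constructor
  · rw [← hΦ.integrable_comp hmeas]
    simp only [Function.comp_def, hcomp]
    exact Integrable.fintype_prod fun p => integrable_cellWeight _ (hre p.1 p.2)
  · have : ∫ u, matrixIntegrand n s lam nu (expExt n u)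
        = ∫ u, matrixIntegrand n s lam nu (expExt n (Φ u)) := by
      conv_lhs => rw [← hΦ.map_eq]
      exact integral_map hΦ.measurable.aemeasurable (by rw [hΦ.map_eq]; exact hmeas)
    simp_rw [this, hcomp]
    rw [integral_fintype_prod_volume_eq_prod (fun (p : Fin n × Fin n) v =>
      cellWeight (if p.1 = p.2 then Real.log s else 0) (lam p.1 + nu p.2) v)]
    simp_rw [fun p : Fin n × Fin n => integral_cellWeight
      (if p.1 = p.2 then Real.log s else 0) (hre p.1 p.2)]
    rw [Finset.prod_mul_distrib, Fintype.prod_prod_type, Fintype.prod_prod_type]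
    congr 1
    · rw [← Finset.sum_neg_distrib, Finset.sum_mul, Complex.exp_sum]
      refine Finset.prod_congr rfl fun i _ => ?_
      rw [Finset.prod_eq_single i]
      · simp [add_comm]
      · intro j _ hj
        simp [hj.symm]
      · simp
    · rw [Finset.prod_comm]
      simp_rw [add_comm]

end gamma

section coordinates

variable {ι : Type*}

lemma image_pi_exp : (fun (u : ι → ℝ) i => Real.exp (u i)) '' Set.univ = {x | ∀ i, 0 < x i} := by
  ext x
  simp only [Set.image_univ, Set.mem_range, Set.mem_ofPred_eq]
  refine ⟨?_, fun hx => ⟨fun i => Real.log (x i), funext fun i => Real.exp_log (hx i)⟩⟩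
  rintro ⟨u, rfl⟩ i
  exact Real.exp_pos _

lemma injOn_pi_exp : Set.InjOn (fun (u : ι → ℝ) i => Real.exp (u i)) Set.univ :=
  fun _ _ _ _ h => funext fun i => Real.exp_injective (congrFun h i)

variable [Fintype ι]

lemma hasFDerivWithinAt_pi_exp (u : ι → ℝ) :
    HasFDerivWithinAt (fun (u : ι → ℝ) i => Real.exp (u i))
      (ContinuousLinearMap.pi fun i =>
        (Real.exp (u i) • ContinuousLinearMap.id ℝ ℝ).comp (ContinuousLinearMap.proj i))
      Set.univ u := by
  rw [hasFDerivWithinAt_pi]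
  intro i
  have := ((ContinuousLinearMap.proj (R := ℝ) (φ := fun _ : ι => ℝ) i).hasFDerivAt (x := u)).exp
  refine (this.congr_fderiv ?_).hasFDerivWithinAt
  ext
  simp

lemma abs_det_pi_exp (u : ι → ℝ) :
    |(ContinuousLinearMap.pi fun i => (Real.exp (u i) • ContinuousLinearMap.id ℝ ℝ).comp
      (ContinuousLinearMap.proj (R := ℝ) (φ := fun _ : ι => ℝ) i)).det| = ∏ i, Real.exp (u i) := by
  rw [ContinuousLinearMap.det_pi]
  simp [abs_of_pos, Finset.prod_pos, Real.exp_pos, ContinuousLinearMap.det]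

lemma prod_exp_smul (g : (ι → ℝ) → ℂ) (u : ι → ℝ) :
    (∏ i, Real.exp (u i)) • (g (fun i => Real.exp (u i)) * ((∏ i, (Real.exp (u i))⁻¹ : ℝ) : ℂ))
      = g (fun i => Real.exp (u i)) := by
  have h : (∏ i, Real.exp (u i)) * ∏ i, (Real.exp (u i))⁻¹ = 1 := by
    rw [← Finset.prod_mul_distrib]
    exact Finset.prod_eq_one fun i _ => mul_inv_cancel₀ (Real.exp_pos _).ne'
  rw [Complex.real_smul, mul_left_comm, ← Complex.ofReal_mul, h, Complex.ofReal_one, mul_one]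

lemma integral_orthant_eq_integral_exp (g : (ι → ℝ) → ℂ) :
    ∫ x in {x : ι → ℝ | ∀ i, 0 < x i}, g x * ((∏ i, (x i)⁻¹ : ℝ) : ℂ)
      = ∫ u : ι → ℝ, g (fun i => Real.exp (u i)) := by
  rw [← image_pi_exp, integral_image_eq_integral_abs_det_fderiv_smul volume MeasurableSet.univ
    (fun u _ => hasFDerivWithinAt_pi_exp u) injOn_pi_exp, setIntegral_univ]
  simp_rw [abs_det_pi_exp, prod_exp_smul]

lemma integrableOn_orthant_iff_integrable_exp (g : (ι → ℝ) → ℂ) :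
    IntegrableOn (fun x => g x * ((∏ i, (x i)⁻¹ : ℝ) : ℂ)) {x : ι → ℝ | ∀ i, 0 < x i}
      ↔ Integrable (fun u : ι → ℝ => g (fun i => Real.exp (u i))) := by
  rw [← image_pi_exp, integrableOn_image_iff_integrableOn_abs_det_fderiv_smul volume
    MeasurableSet.univ (fun u _ => hasFDerivWithinAt_pi_exp u) injOn_pi_exp, integrableOn_univ]
  simp_rw [abs_det_pi_exp, prod_exp_smul]

lemma volume_preserving_piCurry {κ : ι → Type*} [∀ i, Fintype (κ i)] :
    MeasurePreserving (MeasurableEquiv.piCurry (fun (i : ι) (_ : κ i) => ℝ)) := by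
  refine ⟨MeasurableEquiv.measurable _, Eq.symm ?_⟩
  refine Measure.pi_eq_generateFrom
    (C := fun i => Set.pi Set.univ '' Set.pi Set.univ fun _ : κ i => {s : Set ℝ | MeasurableSet s})
    (fun i => generateFrom_pi) (fun i => isPiSystem_pi)
    (fun i => Measure.FiniteSpanningSetsIn.pi fun _ => (volume : Measure ℝ).toFiniteSpanningSetsIn)
    fun s hs => ?_
  choose r hr hrs using hs
  have hpre : (MeasurableEquiv.piCurry (fun (i : ι) (_ : κ i) => ℝ)) ⁻¹' Set.pi Set.univ s
      = Set.pi Set.univ fun p : Σ i, κ i => r p.1 p.2 := by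
    ext v
    simp only [← hrs, Set.mem_preimage, Set.mem_pi, Set.mem_univ, true_imp_iff, Sigma.forall]
    rfl
  rw [MeasurableEquiv.map_apply, hpre, volume_pi_pi, Fintype.prod_sigma]
  refine Finset.prod_congr rfl fun i _ => ?_
  rw [← hrs, Measure.pi_pi]

lemma Psi_eq_integral_exp (n : ℕ) (lam : Fin n → ℂ) (x : Fin n → ℝ) :
    Psi n lam x = ∫ v : (Σ k : Fin (n - 1), Fin (k.1 + 1)) → ℝ,
      wfun n lam x (fun k j => Real.exp (v ⟨k, j⟩)) *
        (Real.exp (-Ffun n x (fun k j => Real.exp (v ⟨k, j⟩))) : ℂ) := by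
  have hmp := volume_preserving_piCurry (κ := fun k : Fin (n - 1) => Fin (k.1 + 1))
  rw [Psi, ← hmp.setIntegral_preimage_emb (MeasurableEquiv.measurableEmbedding _),
    ← integral_orthant_eq_integral_exp fun v : (Σ k : Fin (n - 1), Fin (k.1 + 1)) → ℝ =>
      wfun n lam x (fun k j => v ⟨k, j⟩) * (Real.exp (-Ffun n x (fun k j => v ⟨k, j⟩)) : ℂ)]
  have hset : (MeasurableEquiv.piCurry (fun (k : Fin (n - 1)) (_ : Fin (k.1 + 1)) => ℝ)) ⁻¹' GTpos n
      = {v | ∀ p, 0 < v p} := by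
    ext v
    simp only [GTpos, Set.mem_preimage, Set.mem_ofPred_eq, Sigma.forall]
    rfl
  rw [hset]
  congr 1
  ext v
  rw [GTdens, Fintype.prod_sigma]
  rfl

end coordinates

section assembly

variable {n : ℕ}

abbrev GTIndex (n : ℕ) := Σ k : Fin (n - 1), Fin (k.1 + 1)

/-- The cells of an `n × n` square, split into the main diagonal and the two open triangles. -/
def cellOf (n : ℕ) : Fin n ⊕ GTIndex n ⊕ GTIndex n → Fin n × Fin n
  | .inl j => (⟨n - 1 - j, by omega⟩, ⟨n - 1 - j, by omega⟩)
  | .inr (.inl ⟨k, j⟩) => (⟨k - j, by omega⟩, ⟨n - 1 - j, by omega⟩)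
  | .inr (.inr ⟨k, j⟩) => (⟨n - 1 - j, by omega⟩, ⟨k - j, by omega⟩)

lemma GTIndex_ext {p q : GTIndex n} (h1 : p.1.1 = q.1.1) (h2 : p.2.1 = q.2.1) : p = q := by
  obtain ⟨⟨k, hk⟩, ⟨j, hj⟩⟩ := p
  obtain ⟨⟨k', hk'⟩, ⟨j', hj'⟩⟩ := q
  obtain rfl : k = k' := h1
  obtain rfl : j = j' := h2
  rfl

lemma cellOf_bijective (n : ℕ) : Function.Bijective (cellOf n) := by
  constructor
  · rintro (i | p | p) (j | q | q) h <;>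
      simp only [cellOf, Prod.mk.injEq, Fin.mk.injEq] at h
    · congr 1
      ext
      omega
    · omega
    · omega
    · omega
    · rw [GTIndex_ext (p := p) (q := q) (by omega) (by omega)]
    · omega
    · omega
    · omega
    · rw [GTIndex_ext (p := p) (q := q) (by omega) (by omega)]
  · rintro ⟨⟨a, ha⟩, ⟨b, hb⟩⟩
    rcases lt_trichotomy a b with h | rfl | h
    · refine ⟨.inr (.inl ⟨⟨a + (n - 1 - b), by omega⟩, ⟨n - 1 - b, by simp only; omega⟩⟩), ?_⟩
      simp only [cellOf, Prod.mk.injEq, Fin.mk.injEq]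
      omega
    · refine ⟨.inl ⟨n - 1 - a, by omega⟩, ?_⟩
      simp only [cellOf, Prod.mk.injEq, Fin.mk.injEq]
      omega
    · refine ⟨.inr (.inr ⟨⟨b + (n - 1 - a), by omega⟩, ⟨n - 1 - a, by simp only; omega⟩⟩), ?_⟩
      simp only [cellOf, Prod.mk.injEq, Fin.mk.injEq]
      omega

noncomputable def cellEquiv (n : ℕ) : Fin n ⊕ GTIndex n ⊕ GTIndex n ≃ Fin n × Fin n :=
  Equiv.ofBijective (cellOf n) (cellOf_bijective n)

noncomputable def assemble (n : ℕ) :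
    (Fin n → ℝ) × (GTIndex n → ℝ) × (GTIndex n → ℝ) ≃ᵐ (Fin n × Fin n → ℝ) :=
  ((MeasurableEquiv.refl _).prodCongr
    (MeasurableEquiv.sumPiEquivProdPi fun _ : GTIndex n ⊕ GTIndex n => ℝ).symm).trans
  ((MeasurableEquiv.sumPiEquivProdPi fun _ : Fin n ⊕ GTIndex n ⊕ GTIndex n => ℝ).symm.trans
    (MeasurableEquiv.piCongrLeft (fun _ => ℝ) (cellEquiv n)))

lemma measurePreserving_assemble (n : ℕ) : MeasurePreserving (assemble n) :=
  (volume_measurePreserving_piCongrLeft (fun _ => ℝ) (cellEquiv n)).comp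
    ((volume_measurePreserving_sumPiEquivProdPi_symm
      (fun _ : Fin n ⊕ GTIndex n ⊕ GTIndex n => ℝ)).comp
      ((MeasurePreserving.id _).prod (volume_measurePreserving_sumPiEquivProdPi_symm
        (fun _ : GTIndex n ⊕ GTIndex n => ℝ))))

variable (y : Fin n → ℝ) (v v' : GTIndex n → ℝ)

lemma assemble_apply_cellOf (c : Fin n ⊕ GTIndex n ⊕ GTIndex n) :
    assemble n (y, v, v') (cellOf n c) = Sum.elim y (Sum.elim v v') c := by
  refine (Equiv.piCongrLeft_apply_apply (fun _ => ℝ) (cellEquiv n) _ c).trans ?_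
  rcases c with i | p | p <;> rfl

lemma Zent_eq_upper (k j : ℕ) (hj : j ≤ k) (hk : k < n) :
    Zent n (fun i => Real.exp (y i)) (fun k j => Real.exp (v ⟨k, j⟩)) k j
      = expExt n (assemble n (y, v, v')) (k - j, n - 1 - j) := by
  have hpos : k - j < n ∧ n - 1 - j < n := by omega
  rw [expExt, dif_pos hpos, Zent]
  split_ifs with h1 h2 h3
  · exact congrArg Real.exp (assemble_apply_cellOf y v v' (.inr (.inl ⟨⟨k, h1⟩, ⟨j, h2⟩⟩))).symm
  · omega
  · obtain rfl : k = n - 1 := by omega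
    exact congrArg Real.exp (assemble_apply_cellOf y v v' (.inl ⟨j, h3⟩)).symm
  · omega

lemma Zent_eq_lower (k j : ℕ) (hj : j ≤ k) (hk : k < n) :
    Zent n (fun i => Real.exp (y i)) (fun k j => Real.exp (v' ⟨k, j⟩)) k j
      = expExt n (assemble n (y, v, v')) (n - 1 - j, k - j) := by
  have hpos : n - 1 - j < n ∧ k - j < n := by omega
  rw [expExt, dif_pos hpos, Zent]
  split_ifs with h1 h2 h3
  · exact congrArg Real.exp (assemble_apply_cellOf y v v' (.inr (.inr ⟨⟨k, h1⟩, ⟨j, h2⟩⟩))).symm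
  · omega
  · obtain rfl : k = n - 1 := by omega
    exact congrArg Real.exp (assemble_apply_cellOf y v v' (.inl ⟨j, h3⟩)).symm
  · omega

lemma matrixIntegrand_assemble (hn : n - 1 < n) (s : ℝ) (lam nu : Fin n → ℂ) :
    matrixIntegrand n s lam nu (expExt n (assemble n (y, v, v')))
      = (Real.exp (-(s / Real.exp (y ⟨n - 1, hn⟩))) : ℂ) *
        ((wfun n lam (fun i => Real.exp (y i)) (fun k j => Real.exp (v ⟨k, j⟩)) *
          (Real.exp (-Ffun n (fun i => Real.exp (y i)) (fun k j => Real.exp (v ⟨k, j⟩))) : ℂ)) *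
        (wfun n nu (fun i => Real.exp (y i)) (fun k j => Real.exp (v' ⟨k, j⟩)) *
          (Real.exp (-Ffun n (fun i => Real.exp (y i)) (fun k j => Real.exp (v' ⟨k, j⟩))) : ℂ))) := by
  have hup := Zent_eq_upper y v v'
  have hlow := Zent_eq_lower y v v'
  have hw := wfun_eq_prod (t := fun p => expExt n (assemble n (y, v, v')) p.swap) hlow
  have hF := Ffun_eq_triangleSum (t := fun p => expExt n (assemble n (y, v, v')) p.swap) hlow
  have hcorner : Real.exp (y ⟨n - 1, hn⟩) = expExt n (assemble n (y, v, v')) (0, 0) := by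
    have := hup (n - 1) (n - 1) le_rfl (by omega)
    rw [Nat.sub_self, Zent, dif_neg (lt_irrefl _), dif_pos (by omega)] at this
    exact this
  rw [wfun_eq_prod hup, hw, Ffun_eq_triangleSum hup, hF, hcorner, matrixIntegrand]
  obtain ⟨m, rfl⟩ : ∃ m, n = m + 1 := ⟨n - 1, by omega⟩
  rw [energy_square, neg_add, neg_add, Real.exp_add, Real.exp_add]
  simp_rw [diagProd_swap]
  push_cast
  ring

end assembly

/-- Theorem 5.3 (Stade; the Cauchy-type identity for Whittaker functions): for
`s > 0` and `Re(λᵢ + νⱼ) > 0` for all `i, j`,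
`∫_{ℝ_{>0}ⁿ} e^{−s/xₙ} Ψⁿ_ν(x) Ψⁿ_λ(x) Π dxᵢ/xᵢ
  = s^{−Σ(νᵢ+λᵢ)} Π_{i,j} Γ(νᵢ + λⱼ)`,
the integrand being absolutely integrable. -/
theorem whittaker_cauchy_identity (n : ℕ) (hn : 1 ≤ n) (s : ℝ) (hs : 0 < s)
    (lam nu : Fin n → ℂ) (hre : ∀ i j, 0 < (lam i + nu j).re) :
    IntegrableOn
      (fun x : Fin n → ℝ =>
        (Real.exp (-(s / x ⟨n - 1, by omega⟩)) : ℂ) * Psi n nu x * Psi n lam x *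
          ((∏ i, (x i)⁻¹ : ℝ) : ℂ))
      {x | ∀ i, 0 < x i} ∧
    ∫ x in {x : Fin n → ℝ | ∀ i, 0 < x i},
        (Real.exp (-(s / x ⟨n - 1, by omega⟩)) : ℂ) * Psi n nu x * Psi n lam x *
          ((∏ i, (x i)⁻¹ : ℝ) : ℂ) =
      Complex.exp ((-(∑ i, (nu i + lam i))) * (Real.log s : ℂ)) *
        ∏ i, ∏ j, Complex.Gamma (nu i + lam j) := by
  obtain ⟨hint, hval⟩ := integral_matrixIntegrand hs lam nu hre
  rw [integrableOn_orthant_iff_integrable_exp fun x : Fin n → ℝ =>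
      (Real.exp (-(s / x ⟨n - 1, by omega⟩)) : ℂ) * Psi n nu x * Psi n lam x,
    integral_orthant_eq_integral_exp fun x : Fin n → ℝ =>
      (Real.exp (-(s / x ⟨n - 1, by omega⟩)) : ℂ) * Psi n nu x * Psi n lam x]
  have hmp := measurePreserving_assemble n
  have hfiber : ∀ y : Fin n → ℝ,
      (Real.exp (-(s / Real.exp (y ⟨n - 1, by omega⟩))) : ℂ) * Psi n nu (fun i => Real.exp (y i)) *
        Psi n lam (fun i => Real.exp (y i))
      = ∫ q : (GTIndex n → ℝ) × (GTIndex n → ℝ),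
          matrixIntegrand n s lam nu (expExt n (assemble n (y, q))) := by
    intro y
    have hq : ∀ q : (GTIndex n → ℝ) × (GTIndex n → ℝ), _ := fun q =>
      matrixIntegrand_assemble y q.1 q.2 (by omega) s lam nu
    simp_rw [hq]
    rw [integral_const_mul, Measure.volume_eq_prod, integral_prod_mul
      (fun a : GTIndex n → ℝ => wfun n lam (fun i => Real.exp (y i)) (fun k j => Real.exp (a ⟨k, j⟩)) *
        (Real.exp (-Ffun n (fun i => Real.exp (y i)) (fun k j => Real.exp (a ⟨k, j⟩))) : ℂ))
      (fun a : GTIndex n → ℝ => wfun n nu (fun i => Real.exp (y i)) (fun k j => Real.exp (a ⟨k, j⟩)) *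
        (Real.exp (-Ffun n (fun i => Real.exp (y i)) (fun k j => Real.exp (a ⟨k, j⟩))) : ℂ)),
      Psi_eq_integral_exp, Psi_eq_integral_exp]
    ring
  simp_rw [hfiber]
  rw [← hmp.integrable_comp_emb (assemble n).measurableEmbedding, Function.comp_def,
    Measure.volume_eq_prod] at hint
  rw [← hmp.integral_comp (assemble n).measurableEmbedding, Measure.volume_eq_prod,
    integral_prod _ hint] at hval
  exact ⟨hint.integral_prod_left, hval⟩
end
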